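/- For the Euclidean control system with Hamiltonians H_u(q,p) = |p|²/2 + V_0(q) + Σ_{j=1}^d u_j q_j + u_{d+1} e^{−|q|²/2}, every horizontal shear (q,p) ↦ (q + ∇g(p), p) with g ∈ C^∞(ℝ^d, ℝ) is small-time approximately reachable. -/

import Mathlib

open MeasureTheory Real

noncomputable section

/-- The phase space `T*ℝ^d = ℝ^d × ℝ^d` (positions `q` and momenta `p`),
identified with `ℝ^{2d}` with the sup norm and the Lebesgue (symplectic volume) measure. -/
abbrev Phase (d : ℕ) := (Fin d → ℝ) × (Fin d → ℝ)

/-- The Hamiltonian vector field of a function `H : Phase d → ℝ`: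
`H⃗(q,p) = (∂_p H(q,p), −∂_q H(q,p))`. -/
def hamVF {d : ℕ} (H : Phase d → ℝ) (x : Phase d) : Phase d :=
  (fun i => fderiv ℝ H x (0, Pi.single i 1),
   fun i => -(fderiv ℝ H x (Pi.single i 1, 0)))

/-- `φ` is the global flow of the (complete) vector field `X`. -/
def IsFlowOf {d : ℕ} (X : Phase d → Phase d) (φ : ℝ → Phase d → Phase d) : Prop :=
  (∀ x, φ 0 x = x) ∧ ∀ x t, HasDerivAt (fun s => φ s x) (X (φ t x)) t

/-- `Φ` is a smooth diffeomorphism of phase space. -/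
def IsDiffeo {d : ℕ} (Φ : Phase d → Phase d) : Prop :=
  ContDiff ℝ (⊤ : ℕ∞) Φ ∧
    ∃ Ψ, ContDiff ℝ (⊤ : ℕ∞) Ψ ∧ Function.LeftInverse Ψ Φ ∧ Function.RightInverse Ψ Φ

/-- `Φ` is a Hamiltonian diffeomorphism of `T*ℝ^d`: a smooth diffeomorphism which is the
time-1 flow map of a smooth time-dependent Hamiltonian whose non-autonomous Hamiltonian flow
is defined on `[0,1]` from every initial point. -/
def IsHamDiffeo {d : ℕ} (Φ : Phase d → Phase d) : Prop :=
  IsDiffeo Φ ∧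
  ∃ (H : ℝ → Phase d → ℝ) (φ : ℝ → Phase d → Phase d),
    ContDiff ℝ (⊤ : ℕ∞) (fun z : ℝ × Phase d => H z.1 z.2) ∧
    (∀ x, φ 0 x = x) ∧
    (∀ x, ∀ t ∈ Set.Icc (0:ℝ) 1,
      HasDerivWithinAt (fun s => φ s x) (hamVF (H t) (φ t x)) (Set.Icc (0:ℝ) 1) t) ∧
    Φ = φ 1

/-- `Φ` is the flow map from time `0` to time `τ` of the time-dependent Hamiltonian vector
field `H⃗_{u(t)}` for some piecewise constant control `u(·) : [0,τ] → U` (finitely many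
pieces): i.e. `Φ` is a finite composition of flows of the autonomous fields `H⃗_{u_i}`
for nonnegative durations summing to `τ`. -/
def Reachable {d : ℕ} {U : Type*} (Ham : U → Phase d → ℝ) (τ : ℝ)
    (Φ : Phase d → Phase d) : Prop :=
  ∃ (n : ℕ) (dur : Fin n → ℝ) (u : Fin n → U) (φ : Fin n → ℝ → Phase d → Phase d),
    (∀ i, 0 ≤ dur i) ∧ (∑ i, dur i) = τ ∧
    (∀ i, IsFlowOf (hamVF (Ham (u i))) (φ i)) ∧
    Φ = (List.ofFn (fun i => φ i (dur i))).foldl (fun g f => f ∘ g) id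

/-- `‖Φ − Ψ‖_{C^ℓ(K)} < ε`: all iterated derivatives of the difference up to order `ℓ`
are smaller than `ε` on `K`. -/
def CloseCl {d : ℕ} (ℓ : ℕ) (K : Set (Phase d)) (ε : ℝ) (Φ Ψ : Phase d → Phase d) : Prop :=
  ∀ j ≤ ℓ, ∀ x ∈ K, ‖iteratedFDeriv ℝ j (fun y => Φ y - Ψ y) x‖ < ε

/-- `Ψ ∈ R̄_st`: the diffeomorphism `Ψ` is small-time approximately reachable for the
control system with controlled Hamiltonians `Ham u`, `u ∈ U`. -/
def SmallTimeReachable {d : ℕ} {U : Type*} (Ham : U → Phase d → ℝ)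
    (Ψ : Phase d → Phase d) : Prop :=
  ∀ ε > 0, ∀ K : Set (Phase d), IsCompact K → ∀ ℓ : ℕ,
    ∃ τ ∈ Set.Icc (0:ℝ) ε, ∃ Φ, Reachable Ham τ Φ ∧ CloseCl ℓ K ε Φ Ψ

/-- A function `f` with complete Hamiltonian vector field is STAR (small-time approximately
reachable) if its flow at every time `s ∈ ℝ` belongs to `R̄_st`. -/
def IsSTAR {d : ℕ} {U : Type*} (Ham : U → Phase d → ℝ) (f : Phase d → ℝ) : Prop :=
  (∃ φ, IsFlowOf (hamVF f) φ) ∧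
  ∀ φ, IsFlowOf (hamVF f) φ → ∀ s : ℝ, SmallTimeReachable Ham (φ s)

/-- The Poisson bracket `{f,g} = Σ_j (∂_{p_j} f ∂_{q_j} g − ∂_{q_j} f ∂_{p_j} g)`. -/
def poissonBracket {d : ℕ} (f g : Phase d → ℝ) : Phase d → ℝ :=
  fun x => ∑ j, (fderiv ℝ f x (0, Pi.single j 1) * fderiv ℝ g x (Pi.single j 1, 0)
      - fderiv ℝ f x (Pi.single j 1, 0) * fderiv ℝ g x (0, Pi.single j 1))

/-- The mechanical Hamiltonian `H_u(q,p) = |p|²/2 + V_0(q) + Σ_j u_j V_j(q)`. -/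
def mechHam {d m : ℕ} (V0 : (Fin d → ℝ) → ℝ) (V : Fin m → (Fin d → ℝ) → ℝ)
    (u : Fin m → ℝ) : Phase d → ℝ :=
  fun x => (∑ i, (x.2 i) ^ 2) / 2 + V0 x.1 + ∑ j, u j * V j x.1

/-- The Euclidean controlled Hamiltonian
`H_u(q,p) = |p|²/2 + V_0(q) + Σ_{j=1}^d u_j q_j + u_{d+1} e^{−|q|²/2}`,
with control `u ∈ ℝ^d × ℝ ≃ ℝ^{d+1}`. -/
def eucHam {d : ℕ} (V0 : (Fin d → ℝ) → ℝ) (u : (Fin d → ℝ) × ℝ) : Phase d → ℝ :=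
  fun x => (∑ i, (x.2 i) ^ 2) / 2 + V0 x.1 + (∑ j, u.1 j * x.1 j)
    + u.2 * Real.exp (-(∑ i, (x.1 i) ^ 2) / 2)

/-- The frequencies `k_1 = e_1, …, k_{d−1} = e_{d−1}, k_d = (1,…,1)`. -/
def kvec (d : ℕ) (j : Fin d) : Fin d → ℝ :=
  if (j : ℕ) < d - 1 then Pi.single j 1 else fun _ => 1

/-- The torus controlled Hamiltonian (lifted to `ℝ^d × ℝ^d`)
`H_u(q,p) = |p|²/2 + V_0(q) + Σ_{j=1}^d (u_{2j−1} cos(k_j·q) + u_{2j} sin(k_j·q))`,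
with control `u ∈ (ℝ²)^d ≃ ℝ^{2d}`. -/
def torusHam {d : ℕ} (V0 : (Fin d → ℝ) → ℝ) (u : Fin d → ℝ × ℝ) : Phase d → ℝ :=
  fun x => (∑ i, (x.2 i) ^ 2) / 2 + V0 x.1 +
    ∑ j, ((u j).1 * Real.cos (∑ i, kvec d j i * x.1 i) +
          (u j).2 * Real.sin (∑ i, kvec d j i * x.1 i))

/-- The vertical shear `(q,p) ↦ (q, p − ∇f(q))`. -/
def vshear {d : ℕ} (f : (Fin d → ℝ) → ℝ) : Phase d → Phase d :=
  fun x => (x.1, fun i => x.2 i - fderiv ℝ f x.1 (Pi.single i 1))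

/-- The horizontal shear `(q,p) ↦ (q + ∇g(p), p)`. -/
def hshear {d : ℕ} (g : (Fin d → ℝ) → ℝ) : Phase d → Phase d :=
  fun x => (fun i => x.1 i + fderiv ℝ g x.2 (Pi.single i 1), x.2)

/-- `M` is a mesh of size `h`: the closed sup-norm cubes `C̄(m_n,h)` cover `ℝ^{2d}` and the
open cubes `C(m_n,h)` are pairwise disjoint. -/
def IsMesh {d : ℕ} (h : ℝ) (M : ℕ → Phase d) : Prop :=
  (∀ x : Phase d, ∃ n, ‖x - M n‖ ≤ h) ∧
  ∀ n ℓ : ℕ, n ≠ ℓ →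
    Disjoint {x : Phase d | ‖x - M n‖ < h} {x : Phase d | ‖x - M ℓ‖ < h}

/-- `F` is a permutation of the mesh `M` of size `h`: a bijection translating every open
cube of the mesh onto another one. -/
def IsMeshPermutation {d : ℕ} (h : ℝ) (M : ℕ → Phase d) (F : Phase d → Phase d) : Prop :=
  Function.Bijective F ∧
  ∀ n : ℕ, ∃ ℓ : ℕ, ∀ x : Phase d, ‖x - M n‖ < h → F x = x + (M ℓ - M n)

/-- The fundamental domain `Q = [0,2π)^d × ℝ^d` of `T*𝕋^d` in `ℝ^d × ℝ^d`. -/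
def torusBlock (d : ℕ) : Set (Phase d) :=
  {x : Phase d | ∀ i, 0 ≤ x.1 i ∧ x.1 i < 2 * Real.pi}

/-- A torus density of class `L^r`: a measurable function on `ℝ^d × ℝ^d`, `2π`-periodic in
each position variable, with finite `L^r` norm on the fundamental domain `Q`. -/
def IsTorusDensity {d : ℕ} (p : ENNReal) (ρ : Phase d → ℝ) : Prop :=
  Measurable ρ ∧
  (∀ (q : Fin d → ℝ) (pp : Fin d → ℝ) (k : Fin d → ℤ),
    ρ (fun i => q i + 2 * Real.pi * (k i), pp) = ρ (q, pp)) ∧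
  eLpNorm ρ p (volume.restrict (torusBlock d)) < ⊤

end

section partP1
open Set Filter Topology
open scoped ContDiff

section cc
variable {ι : Type} {E G K : Type} [NormedAddCommGroup E] [NormedSpace ℝ E]
  [NormedAddCommGroup G] [NormedSpace ℝ G] [NormedAddCommGroup K] [NormedSpace ℝ K]

/-- Continuous convergence of all derivatives of order at most `n`. -/
def CC (l : Filter ι) (n : ℕ) (F : ι → E → G) (f : E → G) : Prop :=
  ∀ j ≤ n, ∀ x, Tendsto (fun z : ι × E => iteratedFDeriv ℝ j (F z.1) z.2) (l ×ˢ 𝓝 x)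
    (𝓝 (iteratedFDeriv ℝ j f x))

lemma CC.mono {l : Filter ι} {n m : ℕ} {F : ι → E → G} {f : E → G} (h : CC l n F f)
    (hm : m ≤ n) : CC l m F f := fun j hj => h j (hj.trans hm)

lemma CC.congr {l : Filter ι} {n : ℕ} {F F' : ι → E → G} {f : E → G} (h : CC l n F f)
    (hF : ∀ᶠ i in l, F i = F' i) : CC l n F' f := by
  intro j hj x
  refine (h j hj x).congr' ?_
  filter_upwards [hF.prod_inl (𝓝 x)] with z hz
  rw [hz]

lemma CC_zero {l : Filter ι} {F : ι → E → G} {f : E → G} :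
    CC l 0 F f ↔ ∀ x, Tendsto (fun z : ι × E => F z.1 z.2) (l ×ˢ 𝓝 x) (𝓝 (f x)) := by
  constructor
  · intro h x
    have := h 0 le_rfl x
    simp only [iteratedFDeriv_zero_eq_comp, Function.comp_apply] at this
    have h2 := ((continuousMultilinearCurryFin0 ℝ E G).continuous.tendsto _).comp this
    simpa [Function.comp_def] using h2
  · intro h j hj x
    obtain rfl : j = 0 := by omega
    simp only [iteratedFDeriv_zero_eq_comp, Function.comp_apply]
    exact ((continuousMultilinearCurryFin0 ℝ E G).symm.continuous.tendsto _).comp (h x)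

lemma CC_succ {l : Filter ι} {n : ℕ} {F : ι → E → G} {f : E → G} :
    CC l (n + 1) F f ↔ CC l 0 F f ∧ CC l n (fun i => fderiv ℝ (F i)) (fderiv ℝ f) := by
  constructor
  · intro h
    refine ⟨h.mono (by omega), ?_⟩
    intro j hj x
    have := h (j + 1) (by omega) x
    simp only [iteratedFDeriv_succ_eq_comp_right, Function.comp_apply] at this
    have h2 := ((continuousMultilinearCurryRightEquiv' ℝ j E G).continuous.tendsto _).comp this
    simpa [Function.comp_def] using h2
  · rintro ⟨h0, h⟩ j hj x
    rcases j with _ | j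
    · exact h0 0 le_rfl x
    · have := h j (by omega) x
      simp only [iteratedFDeriv_succ_eq_comp_right, Function.comp_apply]
      exact ((continuousMultilinearCurryRightEquiv' ℝ j E G).symm.continuous.tendsto _).comp this

lemma CC_const {l : Filter ι} {n : ℕ} {f : E → G} (hf : ContDiff ℝ ∞ f) :
    CC l n (fun _ => f) f := by
  intro j _ x
  exact ((hf.continuous_iteratedFDeriv (m := j) (by exact_mod_cast le_top)).tendsto x).comp
    tendsto_snd

lemma CC.add {l : Filter ι} {n : ℕ} {F H : ι → E → G} {f h : E → G} (hF : CC l n F f)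
    (hH : CC l n H h) (sF : ∀ᶠ i in l, ContDiff ℝ ∞ (F i)) (sH : ∀ᶠ i in l, ContDiff ℝ ∞ (H i))
    (sf : ContDiff ℝ ∞ f) (sh : ContDiff ℝ ∞ h) :
    CC l n (fun i x => F i x + H i x) (fun x => f x + h x) := by
  intro j hj x
  have h1 : iteratedFDeriv ℝ j (fun x => f x + h x) x
      = iteratedFDeriv ℝ j f x + iteratedFDeriv ℝ j h x :=
    iteratedFDeriv_add_apply (sf.of_le (by exact_mod_cast le_top)).contDiffAt
      (sh.of_le (by exact_mod_cast le_top)).contDiffAt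
  rw [h1]
  refine ((hF j hj x).add (hH j hj x)).congr' ?_
  filter_upwards [(sF.and sH).prod_inl (𝓝 x)] with z hz
  exact (iteratedFDeriv_add_apply (hz.1.of_le (by exact_mod_cast le_top)).contDiffAt
      (hz.2.of_le (by exact_mod_cast le_top)).contDiffAt).symm

lemma CC.clm {l : Filter ι} {n : ℕ} {F : ι → E → G} {f : E → G} (hF : CC l n F f)
    (sF : ∀ᶠ i in l, ContDiff ℝ ∞ (F i)) (sf : ContDiff ℝ ∞ f) (L : G →L[ℝ] K) :
    CC l n (fun i x => L (F i x)) (fun x => L (f x)) := by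
  intro j hj x
  have h1 : iteratedFDeriv ℝ j (fun x => L (f x)) x
      = L.compContinuousMultilinearMap (iteratedFDeriv ℝ j f x) :=
    L.iteratedFDeriv_comp_left (f := f) sf.contDiffAt (by exact_mod_cast le_top)
  rw [h1]
  have h2 := ((ContinuousLinearMap.compContinuousMultilinearMapL ℝ (fun _ : Fin j => E) G K
    L).continuous.tendsto (iteratedFDeriv ℝ j f x)).comp (hF j hj x)
  refine h2.congr' ?_
  filter_upwards [sF.prod_inl (𝓝 x)] with z hz
  exact (L.iteratedFDeriv_comp_left (f := F z.1) hz.contDiffAt (by exact_mod_cast le_top)).symm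

lemma CC.prod {l : Filter ι} {n : ℕ} {F : ι → E → G} {f : E → G} {H : ι → E → K} {h : E → K}
    (hF : CC l n F f)
    (hH : CC l n H h) (sF : ∀ᶠ i in l, ContDiff ℝ ∞ (F i)) (sH : ∀ᶠ i in l, ContDiff ℝ ∞ (H i))
    (sf : ContDiff ℝ ∞ f) (sh : ContDiff ℝ ∞ h) :
    CC l n (fun i x => (F i x, H i x)) (fun x => (f x, h x)) := by
  have h1 := hF.clm sF sf (ContinuousLinearMap.inl ℝ G K)
  have h2 := hH.clm sH sh (ContinuousLinearMap.inr ℝ G K)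
  have := h1.add h2
    (sF.mono fun i hi => (ContinuousLinearMap.inl ℝ G K).contDiff.comp hi)
    (sH.mono fun i hi => (ContinuousLinearMap.inr ℝ G K).contDiff.comp hi)
    ((ContinuousLinearMap.inl ℝ G K).contDiff.comp sf)
    ((ContinuousLinearMap.inr ℝ G K).contDiff.comp sh)
  simpa using this

lemma CC.comp (n : ℕ) : ∀ {G K : Type} [NormedAddCommGroup G] [NormedSpace ℝ G]
    [NormedAddCommGroup K] [NormedSpace ℝ K] {l : Filter ι} {F : ι → E → G} {f : E → G}
    {H : ι → G → K} {h : G → K}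
    (_ : CC l n H h) (_ : CC l n F f)
    (_ : ∀ᶠ i in l, ContDiff ℝ ∞ (H i)) (_ : ∀ᶠ i in l, ContDiff ℝ ∞ (F i))
    (_ : ContDiff ℝ ∞ h) (_ : ContDiff ℝ ∞ f),
    CC l n (fun i x => H i (F i x)) (fun x => h (f x)) := by
  induction n with
  | zero =>
    intro G K _ _ _ _ l F f H h hH hF _ _ _ _
    rw [CC_zero] at *
    intro x
    exact (hH (f x)).comp (tendsto_fst.prodMk (hF x))
  | succ n ih =>
    intro G K _ _ _ _ l F f H h hH hF sH sF sh sf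
    rw [CC_succ] at hH hF ⊢
    refine ⟨?_, ?_⟩
    · have h1 := CC_zero.1 hH.1
      have h2 := CC_zero.1 hF.1
      rw [CC_zero]
      intro x
      exact (h1 (f x)).comp (tendsto_fst.prodMk (h2 x))
    · have one : (1 : WithTop ℕ∞) ≤ ∞ := by exact_mod_cast le_top
      have dH : ∀ᶠ i in l, ContDiff ℝ ∞ (fderiv ℝ (H i)) :=
        sH.mono fun i hi => hi.fderiv_right (by simp)
      have dF : ∀ᶠ i in l, ContDiff ℝ ∞ (fderiv ℝ (F i)) :=
        sF.mono fun i hi => hi.fderiv_right (by simp)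
      have dh : ContDiff ℝ ∞ (fderiv ℝ h) := sh.fderiv_right (by simp)
      have df : ContDiff ℝ ∞ (fderiv ℝ f) := sf.fderiv_right (by simp)
      have hF' : CC l n F f := by
        rcases n with _ | n
        · exact hF.1
        · exact CC_succ.2 ⟨hF.1, hF.2.mono (by omega)⟩
      have c1 := ih hH.2 hF' dH sF dh sf
      have c2 := c1.prod hF.2 ((dH.and sF).mono fun i hi => hi.1.comp hi.2) dF (dh.comp sf) df
      let B : (G →L[ℝ] K) × (E →L[ℝ] G) → (E →L[ℝ] K) := fun z => z.1.comp z.2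
      have sB : ContDiff ℝ ∞ B := contDiff_fst.clm_comp contDiff_snd
      have c3 := ih (CC_const (l := l) (n := n) sB) c2 (Eventually.of_forall fun _ => sB)
        (((dH.and sF).and dF).mono fun i hi => (hi.1.1.comp hi.1.2).prodMk hi.2) sB
        ((dh.comp sf).prodMk df)
      have e1 : fderiv ℝ (fun x => h (f x)) = fun x => B (fderiv ℝ h (f x), fderiv ℝ f x) := by
        funext x
        exact fderiv_comp x (sh.differentiable (by simp) _) (sf.differentiable (by simp) _)
      rw [e1]
      refine c3.congr ?_
      filter_upwards [sH, sF] with i h1 h2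
      funext x
      exact (fderiv_comp x (h1.differentiable (by simp) _) (h2.differentiable (by simp) _)).symm

/-- A jointly smooth family converges. -/
lemma CC_of_smooth {P : Type} [NormedAddCommGroup P] [NormedSpace ℝ P] (n : ℕ) :
    ∀ {G : Type} [NormedAddCommGroup G] [NormedSpace ℝ G] {Φ : P × E → G} {U : Set P} {p₀ : P}
    (_ : IsOpen U) (_ : p₀ ∈ U) (_ : ContDiffOn ℝ ∞ Φ (U ×ˢ univ)),
    CC (𝓝 p₀) n (fun p x => Φ (p, x)) (fun x => Φ (p₀, x)) := by
  have base : ∀ {G : Type} [NormedAddCommGroup G] [NormedSpace ℝ G] {Φ : P × E → G} {U : Set P}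
    {p₀ : P}
    (_ : IsOpen U) (_ : p₀ ∈ U) (_ : ContDiffOn ℝ ∞ Φ (U ×ˢ univ)),
    CC (𝓝 p₀) 0 (fun p x => Φ (p, x)) (fun x => Φ (p₀, x)) := by
    intro G _ _ Φ U p₀ hU hp hΦ
    rw [CC_zero]
    intro x
    have : ContinuousAt Φ (p₀, x) := hΦ.continuousOn.continuousAt
      ((hU.prod isOpen_univ).mem_nhds ⟨hp, mem_univ _⟩)
    rw [← nhds_prod_eq]
    exact this
  induction n with
  | zero => exact base
  | succ n ih =>
    intro G _ _ Φ U p₀ hU hp hΦ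
    rw [CC_succ]
    refine ⟨base hU hp hΦ, ?_⟩
    have hO : IsOpen (U ×ˢ (univ : Set E)) := hU.prod isOpen_univ
    have hd : ContDiffOn ℝ ∞ (fun z => (fderiv ℝ Φ z).comp (ContinuousLinearMap.inr ℝ P E))
        (U ×ˢ univ) :=
      (hΦ.fderiv_of_isOpen hO (by simp)).clm_comp contDiffOn_const
    have key : ∀ p ∈ U, fderiv ℝ (fun x => Φ (p, x))
        = fun x => (fderiv ℝ Φ (p, x)).comp (ContinuousLinearMap.inr ℝ P E) := by
      intro p hp'
      funext x
      have h1 : HasFDerivAt Φ (fderiv ℝ Φ (p, x)) (p, x) :=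
        ((hΦ.differentiableOn (by simp)).differentiableAt
          (hO.mem_nhds ⟨hp', mem_univ x⟩)).hasFDerivAt
      exact (h1.comp x (hasFDerivAt_prodMk_right p x)).fderiv
    rw [key p₀ hp]
    refine (ih hU hp hd).congr ?_
    filter_upwards [hU.mem_nhds hp] with p hp'
    exact (key p hp').symm

/-- bundled convergence -/
structure Conv (l : Filter ι) (F : ι → E → G) (f : E → G) : Prop where
  sF : ∀ᶠ i in l, ContDiff ℝ ∞ (F i)
  sf : ContDiff ℝ ∞ f
  cc : ∀ n, CC l n F f

lemma Conv.comp {l : Filter ι} {F : ι → E → G} {f : E → G} {H : ι → G → K} {h : G → K}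
    (hH : Conv l H h) (hF : Conv l F f) :
    Conv l (fun i x => H i (F i x)) (fun x => h (f x)) :=
  ⟨(hH.sF.and hF.sF).mono fun _ hi => hi.1.comp hi.2, hH.sf.comp hF.sf,
    fun n => CC.comp n (hH.cc n) (hF.cc n) hH.sF hF.sF hH.sf hF.sf⟩

lemma Conv.prod {l : Filter ι} {F : ι → E → G} {f : E → G} {H : ι → E → K} {h : E → K}
    (hF : Conv l F f) (hH : Conv l H h) :
    Conv l (fun i x => (F i x, H i x)) (fun x => (f x, h x)) :=
  ⟨(hF.sF.and hH.sF).mono fun _ hi => hi.1.prodMk hi.2, hF.sf.prodMk hH.sf,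
    fun n => (hF.cc n).prod (hH.cc n) hF.sF hH.sF hF.sf hH.sf⟩

lemma Conv.fderiv {l : Filter ι} {F : ι → E → G} {f : E → G} (hF : Conv l F f) :
    Conv l (fun i => fderiv ℝ (F i)) (fderiv ℝ f) :=
  ⟨hF.sF.mono fun _ hi => hi.fderiv_right (by simp), hF.sf.fderiv_right (by simp),
    fun n => (CC_succ.1 (hF.cc (n + 1))).2⟩

lemma Conv_const {l : Filter ι} {f : E → G} (hf : ContDiff ℝ ∞ f) : Conv l (fun _ => f) f :=
  ⟨Eventually.of_forall fun _ => hf, hf, fun _ => CC_const hf⟩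

lemma Conv.mono {l l' : Filter ι} {F : ι → E → G} {f : E → G} (h : Conv l F f) (hl : l' ≤ l) :
    Conv l' F f :=
  ⟨h.sF.filter_mono hl, h.sf, fun n j hj x =>
    (h.cc n j hj x).mono_left (Filter.prod_mono hl le_rfl)⟩

lemma Conv.congr {l : Filter ι} {F F' : ι → E → G} {f : E → G} (h : Conv l F f)
    (hF : ∀ᶠ i in l, F i = F' i) : Conv l F' f :=
  ⟨(h.sF.and hF).mono fun _ hi => hi.2 ▸ hi.1, h.sf, fun n => (h.cc n).congr hF⟩

lemma Conv_of_smooth {P : Type} [NormedAddCommGroup P] [NormedSpace ℝ P] {Φ : P × E → G}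
    {U : Set P} {p₀ : P} (hU : IsOpen U) (hp : p₀ ∈ U) (hΦ : ContDiffOn ℝ ∞ Φ (U ×ˢ univ)) :
    Conv (𝓝 p₀) (fun p x => Φ (p, x)) (fun x => Φ (p₀, x)) := by
  have key : ∀ p ∈ U, ContDiff ℝ ∞ (fun x => Φ (p, x)) := by
    intro p hp'
    rw [← contDiffOn_univ]
    exact hΦ.comp (contDiff_prodMk_right p).contDiffOn fun x _ => ⟨hp', mem_univ x⟩
  exact ⟨by filter_upwards [hU.mem_nhds hp] with p hp' using key p hp', key p₀ hp,
    fun n => CC_of_smooth n hU hp hΦ⟩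

/-- `C^ℓ(K)` closeness for general spaces. -/
def CloseG (ℓ : ℕ) (S : Set E) (ε : ℝ) (Φ Ψ : E → G) : Prop :=
  ∀ j ≤ ℓ, ∀ x ∈ S, ‖iteratedFDeriv ℝ j (fun y => Φ y - Ψ y) x‖ < ε

lemma iteratedFDeriv_sub_smooth {f g : E → G} (hf : ContDiff ℝ ∞ f) (hg : ContDiff ℝ ∞ g)
    (j : ℕ) (x : E) :
    iteratedFDeriv ℝ j (fun y => f y - g y) x
      = iteratedFDeriv ℝ j f x - iteratedFDeriv ℝ j g x :=
  iteratedFDeriv_sub_apply (hf.of_le (by exact_mod_cast le_top)).contDiffAt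
      (hg.of_le (by exact_mod_cast le_top)).contDiffAt

lemma CloseG.trans {ℓ : ℕ} {S : Set E} {ε₁ ε₂ : ℝ} {f g h : E → G} (sf : ContDiff ℝ ∞ f)
    (sg : ContDiff ℝ ∞ g) (sh : ContDiff ℝ ∞ h) (h1 : CloseG ℓ S ε₁ f g)
    (h2 : CloseG ℓ S ε₂ g h) : CloseG ℓ S (ε₁ + ε₂) f h := by
  intro j hj x hx
  have a := h1 j hj x hx
  have b := h2 j hj x hx
  rw [iteratedFDeriv_sub_smooth sf sg] at a
  rw [iteratedFDeriv_sub_smooth sg sh] at b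
  rw [iteratedFDeriv_sub_smooth sf sh]
  calc _ = ‖(iteratedFDeriv ℝ j f x - iteratedFDeriv ℝ j g x) +
        (iteratedFDeriv ℝ j g x - iteratedFDeriv ℝ j h x)‖ := by rw [sub_add_sub_cancel]
    _ ≤ _ := norm_add_le _ _
    _ < _ := add_lt_add a b

lemma Conv.close {l : Filter ι} {F : ι → E → G} {f : E → G} (h : Conv l F f) (ℓ : ℕ)
    {S : Set E} (hS : IsCompact S) {ε : ℝ} (hε : 0 < ε) :
    ∀ᶠ i in l, CloseG ℓ S ε (F i) f := by
  have key : ∀ j ∈ Finset.range (ℓ + 1), ∀ᶠ i in l, ∀ x ∈ S,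
      ‖iteratedFDeriv ℝ j (fun y => F i y - f y) x‖ < ε := by
    intro j _
    have h1 : ∀ x ∈ S, ∀ᶠ z : ι × E in l ×ˢ 𝓝 x,
        ‖iteratedFDeriv ℝ j (fun y => F z.1 y - f y) z.2‖ < ε := by
      intro x _
      have a := h.cc j j le_rfl x
      have b := CC_const (l := l) (n := j) h.sf j le_rfl x
      have c := (a.sub b).norm
      rw [sub_self, norm_zero] at c
      filter_upwards [c.eventually_lt_const hε, h.sF.prod_inl (𝓝 x)] with z hz hz2
      rwa [iteratedFDeriv_sub_smooth hz2 h.sf]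
    have h2 : ∀ᶠ z : ι × E in l ×ˢ 𝓝ˢ S,
        ‖iteratedFDeriv ℝ j (fun y => F z.1 y - f y) z.2‖ < ε := by
      rw [hS.prod_nhdsSet_eq_biSup]
      simpa [Filter.eventually_iSup] using h1
    have h3 := h2.curry
    filter_upwards [h3] with i hi x hx
    exact (hi.self_of_nhdsSet) x hx
  have := (Filter.eventually_all_finset (Finset.range (ℓ + 1))).2 key
  filter_upwards [this] with i hi j hj x hx
  exact hi j (Finset.mem_range.2 (by omega)) x hx

lemma Conv_of_close {F : ℕ → E → G} {f : E → G} (sF : ∀ n, ContDiff ℝ ∞ (F n))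
    (sf : ContDiff ℝ ∞ f)
    (h : ∀ n : ℕ, CloseG n (Metric.closedBall 0 (n : ℝ)) (1 / ((n : ℝ) + 1)) (F n) f) :
    Conv atTop F f := by
  refine ⟨Eventually.of_forall sF, sf, fun n j _ x => ?_⟩
  have b := CC_const (l := (atTop : Filter ℕ)) (n := j) sf j le_rfl x
  have c : Tendsto (fun z : ℕ × E => iteratedFDeriv ℝ j (F z.1) z.2 - iteratedFDeriv ℝ j f z.2)
      (atTop ×ˢ 𝓝 x) (𝓝 0) := by
    have h0 : Tendsto (fun z : ℕ × E => 1 / ((z.1 : ℝ) + 1)) (atTop ×ˢ 𝓝 x) (𝓝 0) :=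
      tendsto_one_div_add_atTop_nhds_zero_nat.comp tendsto_fst
    refine squeeze_zero_norm' ?_ h0
    obtain ⟨m, hm⟩ := exists_nat_gt (‖x‖ + 1)
    have e1 : ∀ᶠ k : ℕ in atTop, max j m ≤ k := eventually_ge_atTop _
    have e2 : ∀ᶠ y in 𝓝 x, y ∈ Metric.ball x 1 := Metric.ball_mem_nhds x one_pos
    filter_upwards [e1.prod_mk e2] with z hz
    rw [← iteratedFDeriv_sub_smooth (sF z.1) sf]
    refine (h z.1 j ((le_max_left _ _).trans hz.1) z.2 ?_).le
    rw [mem_closedBall_zero_iff]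
    have h3 : ‖z.2‖ ≤ ‖x‖ + ‖z.2 - x‖ := by
      simpa using norm_add_le x (z.2 - x)
    have h4 : ‖z.2 - x‖ < 1 := by simpa [dist_eq_norm] using hz.2
    have h5 : (m : ℝ) ≤ z.1 := by exact_mod_cast (le_max_right _ _).trans hz.1
    linarith
  have := c.add b
  simpa using this
end cc

end partP1

section partP2
open Set Filter Topology
open scoped ContDiff NNReal unitInterval

section nemytskii
variable {F G : Type} [NormedAddCommGroup F] [NormedSpace ℝ F] [NormedAddCommGroup G]
  [NormedSpace ℝ G]

/-- pointwise application of a curve of linear maps to a curve -/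
noncomputable def curveApp (F G : Type) [NormedAddCommGroup F] [NormedSpace ℝ F]
    [NormedAddCommGroup G] [NormedSpace ℝ G] :
    C(I, F →L[ℝ] G) →L[ℝ] C(I, F) →L[ℝ] C(I, G) :=
  LinearMap.mkContinuous₂
    (LinearMap.mk₂ ℝ (fun (A : C(I, F →L[ℝ] G)) (h : C(I, F)) => (⟨fun s => A s (h s), by fun_prop⟩ : C(I, G)))
      (by intros; ext; simp) (by intros; ext; simp) (by intros; ext; simp)
      (by intros; ext; simp)) 1 (by
      intro A h
      rw [ContinuousMap.norm_le _ (by positivity)]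
      intro s
      simp only [LinearMap.mk₂_apply, ContinuousMap.coe_mk, one_mul]
      have h1 : ‖A s‖ ≤ ‖A‖ := A.norm_coe_le_norm s
      have h2 : ‖h s‖ ≤ ‖h‖ := h.norm_coe_le_norm s
      exact ((A s).le_opNorm _).trans (by gcongr))

@[simp] lemma curveApp_apply (A : C(I, F →L[ℝ] G)) (h : C(I, F)) (s : I) :
    curveApp F G A h s = A s (h s) := rfl

/-- superposition operator -/
def nem (X : C(F, G)) (η : C(I, F)) : C(I, G) := X.comp η

lemma nem_hasFDerivAt (X : F → G) (hX : ContDiff ℝ 1 X) (η : C(I, F)) :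
    HasFDerivAt (nem ⟨X, hX.continuous⟩)
      (curveApp F G (nem ⟨fderiv ℝ X, hX.continuous_fderiv one_ne_zero⟩ η)) η := by
  rw [hasFDerivAt_iff_isLittleO_nhds_zero, Asymptotics.isLittleO_iff]
  intro c hc
  have hK : IsCompact (range η) := isCompact_range η.continuous
  have hcont : Continuous (fderiv ℝ X) := hX.continuous_fderiv one_ne_zero
  have h1 := hK.uniformContinuousAt_of_continuousAt (fderiv ℝ X)
    (fun a _ => hcont.continuousAt) (Metric.dist_mem_uniformity hc)
  obtain ⟨δ, hδ, hδ'⟩ := Metric.mem_uniformity_dist.1 h1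
  filter_upwards [Metric.ball_mem_nhds (0 : C(I, F)) hδ] with h hh
  rw [mem_ball_zero_iff] at hh
  rw [ContinuousMap.norm_le _ (by positivity)]
  intro s
  simp only [nem, ContinuousMap.sub_apply, ContinuousMap.comp_apply, ContinuousMap.coe_mk,
    ContinuousMap.add_apply, curveApp_apply]
  have hs : ‖h s‖ ≤ ‖h‖ := h.norm_coe_le_norm s
  have hb : ∀ x ∈ Metric.ball (η s) δ, ‖fderiv ℝ X x - fderiv ℝ X (η s)‖ ≤ c := by
    intro x hx
    have h2 : (η s, x) ∈ {p : F × F | dist p.1 p.2 < δ} := by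
      simpa [dist_comm] using hx
    have := hδ' (a := η s) (b := x) (by simpa [dist_comm] using hx) (mem_range_self s)
    simp only [mem_ofPred_eq] at this
    rw [dist_comm, dist_eq_norm] at this
    exact this.le
  have := (convex_ball (η s) δ).norm_image_sub_le_of_norm_fderiv_le' (𝕜 := ℝ) (f := X)
    (x := η s) (y := η s + h s) (C := c) (φ := fderiv ℝ X (η s))
    (fun x _ => (hX.differentiable one_ne_zero) x) hb (Metric.mem_ball_self hδ)
    (by simpa using hs.trans_lt hh)
  simp only [add_sub_cancel_left] at this
  exact this.trans (by gcongr)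

lemma nem_contDiff_nat (n : ℕ) : ∀ {G : Type} [NormedAddCommGroup G] [NormedSpace ℝ G]
    (X : F → G) (hX : ContDiff ℝ ∞ X), ContDiff ℝ n (nem ⟨X, hX.continuous⟩) := by
  induction n with
  | zero =>
    intro G _ _ X hX
    refine contDiff_zero.2 ?_
    exact ContinuousMap.continuous_postcomp _
  | succ n ih =>
    intro G _ _ X hX
    have hX1 : ContDiff ℝ 1 X := hX.of_le (by exact_mod_cast le_top)
    have hd : ContDiff ℝ ∞ (fderiv ℝ X) := hX.fderiv_right (by simp)
    have := fun η => nem_hasFDerivAt X hX1 η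
    push_cast
    rw [contDiff_succ_iff_hasFDerivAt]
    refine ⟨_, ?_, this⟩
    have h0 : ContDiff ℝ n (fun A => curveApp F G A) := by
      exact ContinuousLinearMap.contDiff (𝕜 := ℝ) (E := C(I, F →L[ℝ] G))
        (F := C(I, F) →L[ℝ] C(I, G)) (curveApp F G)
    exact h0.comp (ih (fderiv ℝ X) hd)

lemma nem_contDiff (X : F → G) (hX : ContDiff ℝ ∞ X) :
    ContDiff ℝ ∞ (nem ⟨X, hX.continuous⟩) :=
  contDiff_infty.2 fun n => nem_contDiff_nat n X hX
end nemytskii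

section ode
variable {E : Type} [NormedAddCommGroup E] [NormedSpace ℝ E] [CompleteSpace E]

/-- integration operator on curves -/
noncomputable def curveInt (E : Type) [NormedAddCommGroup E] [NormedSpace ℝ E] [CompleteSpace E] :
    C(I, E) →L[ℝ] C(I, E) :=
  LinearMap.mkContinuous
    { toFun := fun γ => ⟨fun s : I => ∫ t in (0:ℝ)..s, γ (projIcc 0 1 zero_le_one t), by
        have h : Continuous fun x : ℝ => ∫ t in (0:ℝ)..x, γ (projIcc 0 1 zero_le_one t) :=
          intervalIntegral.continuous_primitive
            (fun a b => (γ.continuous.comp continuous_projIcc).intervalIntegrable a b) 0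
        exact h.comp continuous_subtype_val⟩
      map_add' := by
        intro a b
        ext s
        simp only [ContinuousMap.coe_mk, ContinuousMap.add_apply]
        exact intervalIntegral.integral_add
          ((a.continuous.comp continuous_projIcc).intervalIntegrable _ _)
          ((b.continuous.comp continuous_projIcc).intervalIntegrable _ _)
      map_smul' := by
        intro a b
        ext s
        simp }
    1 (by
      intro γ
      rw [ContinuousMap.norm_le _ (by positivity)]
      intro s
      have := intervalIntegral.norm_integral_le_of_norm_le_const (a := (0:ℝ)) (b := s)
        (f := fun t => γ (projIcc 0 1 zero_le_one t)) (C := ‖γ‖)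
        (fun x _ => γ.norm_coe_le_norm _)
      refine this.trans ?_
      rw [sub_zero, abs_of_nonneg s.2.1, one_mul]
      exact mul_le_of_le_one_right (norm_nonneg _) s.2.2)

lemma curveInt_apply (γ : C(I, E)) (s : I) :
    curveInt E γ s = ∫ t in (0:ℝ)..s, γ (projIcc 0 1 zero_le_one t) := rfl

lemma curveInt_norm_le (γ : C(I, E)) : ‖curveInt E γ‖ ≤ ‖γ‖ := by
  have := (curveInt E).le_of_opNorm_le (LinearMap.mkContinuous_norm_le _ zero_le_one _) γ
  simpa using this

variable {Λ : Type} [NormedAddCommGroup Λ] [NormedSpace ℝ Λ] [CompleteSpace Λ]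

/-- constant curves -/
noncomputable def constCurve (Λ : Type) [NormedAddCommGroup Λ] [NormedSpace ℝ Λ] :
    Λ →L[ℝ] C(I, Λ) :=
  LinearMap.mkContinuous
    { toFun := fun x => ContinuousMap.const I x
      map_add' := by intros; ext; simp
      map_smul' := by intros; ext; simp } 1 (by
      intro x
      rw [ContinuousMap.norm_le _ (by positivity)]
      intro s
      simp)

/-- the curve `s ↦ (l, s, γ s)` -/
noncomputable def curveTriple (u : Λ × C(I, E)) : C(I, Λ × ℝ × E) :=
  ⟨fun s => (u.1, (s : ℝ), u.2 s), by fun_prop⟩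

lemma curveTriple_contDiff : ContDiff ℝ ∞ (curveTriple (Λ := Λ) (E := E)) := by
  have : (curveTriple (Λ := Λ) (E := E)) = fun u =>
      (⟨fun s => ((0 : Λ), (s:ℝ), (0:E)), by fun_prop⟩ : C(I, Λ × ℝ × E)) +
      ((ContinuousLinearMap.inl ℝ Λ (ℝ × E)).compLeftContinuous ℝ I
          (constCurve Λ u.1) +
       ((ContinuousLinearMap.inr ℝ Λ (ℝ × E)).comp (ContinuousLinearMap.inr ℝ ℝ E)).compLeftContinuous
          ℝ I u.2) := by
    funext u
    ext s <;> simp [curveTriple, constCurve]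
  rw [this]
  fun_prop

theorem param_ode (X : Λ × ℝ × E → E) (hX : ContDiff ℝ ∞ X) (U : Set Λ) (hU : IsOpen U)
    (κ : ℝ≥0) (hκ : κ < 1)
    (hL : ∀ l ∈ U, ∀ s ∈ Icc (0:ℝ) 1, ∀ y y', ‖X (l, s, y) - X (l, s, y')‖ ≤ κ * ‖y - y'‖) :
    ∃ Y : Λ → E, ContDiffOn ℝ ∞ Y U ∧ ∀ l ∈ U, ∀ γ : ℝ → E, γ 0 = 0 →
      (∀ s ∈ Icc (0:ℝ) 1, HasDerivAt γ (X (l, s, γ s)) s) → Y l = γ 1 := by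
  classical
  set N := nem ⟨X, hX.continuous⟩ with hN
  have hNs : ContDiff ℝ ∞ N := nem_contDiff X hX
  let T : Λ × C(I, E) → C(I, E) := fun u => curveInt E (N (curveTriple u))
  have hT : ContDiff ℝ ∞ T :=
    (curveInt E).contDiff.comp (hNs.comp curveTriple_contDiff)
  have hTl : ∀ l ∈ U, LipschitzWith κ (fun γ => T (l, γ)) := by
    intro l hl
    refine LipschitzWith.of_dist_le_mul fun a b => ?_
    rw [dist_eq_norm, dist_eq_norm]
    simp only [T]
    rw [← map_sub]
    refine (curveInt_norm_le _).trans ?_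
    rw [ContinuousMap.norm_le _ (by positivity)]
    intro s
    refine (hL l hl s s.2 (a s) (b s)).trans ?_
    gcongr
    exact (a - b).norm_coe_le_norm s
  have hfix : ∀ l ∈ U, ∃ γ, T (l, γ) = γ := fun l hl =>
    ⟨_, ContractingWith.fixedPoint_isFixedPt (f := fun γ => T (l, γ)) ⟨hκ, hTl l hl⟩⟩
  have huniq : ∀ l ∈ U, ∀ a b, T (l, a) = a → T (l, b) = b → a = b := fun l hl a b ha hb =>
    ContractingWith.fixedPoint_unique' (f := fun γ => T (l, γ)) ⟨hκ, hTl l hl⟩ ha hb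
  let S : Λ → C(I, E) := fun l => if h : l ∈ U then (hfix l h).choose else 0
  have hS : ∀ l ∈ U, T (l, S l) = S l := by
    intro l hl
    simp only [S, dif_pos hl]
    exact (hfix l hl).choose_spec
  let f : Λ × C(I, E) → C(I, E) := fun u => u.2 - T u
  have hf : ContDiff ℝ ∞ f := contDiff_snd.sub hT
  have hSs : ContDiffOn ℝ ∞ S U := by
    intro l hl
    refine ContDiffAt.contDiffWithinAt ?_
    have hfa : ContDiffAt ℝ ∞ f (l, S l) := hf.contDiffAt
    have hd : HasFDerivAt (fun γ => T (l, γ))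
        (fderiv ℝ T (l, S l) ∘L .inr ℝ Λ C(I, E)) (S l) := by
      have h1 : HasFDerivAt T (fderiv ℝ T (l, S l)) (l, S l) :=
        (hT.differentiable (by simp) _).hasFDerivAt
      exact h1.comp (S l) (hasFDerivAt_prodMk_right l (S l))
    have hn : ‖fderiv ℝ T (l, S l) ∘L .inr ℝ Λ C(I, E)‖ ≤ κ := by
      exact hd.le_of_lipschitz (hTl l hl)
    have hinv : (fderiv ℝ f (l, S l) ∘L .inr ℝ Λ C(I, E)).IsInvertible := by
      have h2 : fderiv ℝ f (l, S l) ∘L .inr ℝ Λ C(I, E)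
          = 1 - fderiv ℝ T (l, S l) ∘L .inr ℝ Λ C(I, E) := by
        have h3 : HasFDerivAt f (.snd ℝ Λ C(I, E) - fderiv ℝ T (l, S l)) (l, S l) :=
          hasFDerivAt_snd.sub (hT.differentiable (by simp) _).hasFDerivAt
        rw [h3.fderiv]
        ext x : 1
        simp
      rw [h2]
      have h4 : IsUnit (1 - fderiv ℝ T (l, S l) ∘L .inr ℝ Λ C(I, E)) :=
        isUnit_one_sub_of_norm_lt_one (R := C(I, E) →L[ℝ] C(I, E)) (hn.trans_lt hκ)
      obtain ⟨v, hv⟩ := h4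
      exact ⟨ContinuousLinearEquiv.unitsEquiv ℝ _ v, by rw [← hv]; rfl⟩
    have hne : (∞ : WithTop ℕ∞) ≠ 0 := by simp
    refine (hfa.contDiffAt_implicitFunction hne hinv).congr_of_eventuallyEq ?_
    have h5 := hfa.eventually_apply_implicitFunction hne hinv
    filter_upwards [h5, hU.mem_nhds hl] with x hx hxU
    refine huniq x hxU _ _ (hS x hxU) ?_
    have h6 : f (l, S l) = 0 := by simp only [f]; rw [hS l hl, sub_self]
    rw [h6] at hx
    exact (sub_eq_zero.1 hx).symm
  refine ⟨fun l => S l 1, ?_, ?_⟩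
  · exact (ContinuousMap.evalCLM ℝ (1 : I)).contDiff.comp_contDiffOn hSs
  · intro l hl γ h0 hγ
    have hc : ContinuousOn γ (Icc 0 1) := fun s hs => (hγ s hs).continuousAt.continuousWithinAt
    let g : C(I, E) := ⟨(Icc (0:ℝ) 1).domRestrict γ, hc.domRestrict⟩
    have hg : T (l, g) = g := by
      ext s
      simp only [T]
      rw [curveInt_apply]
      have hder : ∀ t ∈ uIcc (0:ℝ) s, HasDerivAt γ (X (l, t, γ t)) t := by
        intro t ht
        rw [uIcc_of_le s.2.1] at ht
        exact hγ t ⟨ht.1, ht.2.trans s.2.2⟩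
      have hcongr : ∀ t ∈ uIcc (0:ℝ) s, (N (curveTriple (l, g))) (projIcc 0 1 zero_le_one t)
          = X (l, t, γ t) := by
        intro t ht
        rw [uIcc_of_le s.2.1] at ht
        have ht' : t ∈ Icc (0:ℝ) 1 := ⟨ht.1, ht.2.trans s.2.2⟩
        rw [projIcc_of_mem _ ht']
        rfl
      rw [intervalIntegral.integral_congr hcongr,
        intervalIntegral.integral_eq_sub_of_hasDerivAt hder, h0, sub_zero]
      · rfl
      · refine ContinuousOn.intervalIntegrable ?_
        refine hX.continuous.comp_continuousOn ?_
        refine continuousOn_const.prodMk (continuousOn_id.prodMk ?_)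
        exact hc.mono (by rw [uIcc_of_le s.2.1]; exact Icc_subset_Icc le_rfl s.2.2)
    have := huniq l hl _ _ (hS l hl) hg
    show S l 1 = γ 1
    rw [this]
    rfl
end ode

end partP2

section reach
open Set Filter Topology
open scoped ContDiff
variable {d : ℕ} {U : Type}

lemma Reachable.comp {Ham : U → Phase d → ℝ} {τ σ : ℝ} {Φ Ψ : Phase d → Phase d}
    (h1 : Reachable Ham τ Φ) (h2 : Reachable Ham σ Ψ) :
    Reachable Ham (τ + σ) (fun x => Ψ (Φ x)) := by
  obtain ⟨n, a, u, φ, ha, hs, hf, rfl⟩ := h1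
  obtain ⟨m, b, v, ψ, hb, ht, hg, rfl⟩ := h2
  have key : ∀ (L : List (Phase d → Phase d)) (k : Phase d → Phase d),
      L.foldl (fun g f => f ∘ g) k = (L.foldl (fun g f => f ∘ g) id) ∘ k := by
    intro L
    induction L with
    | nil => intro k; rfl
    | cons f L ih =>
      intro k
      simp only [List.foldl_cons]
      rw [ih, ih (f ∘ id)]
      rfl
  refine ⟨n + m, Fin.append a b, Fin.append u v, Fin.append φ ψ, ?_, ?_, ?_, ?_⟩
  · intro i
    refine Fin.addCases (fun i => ?_) (fun i => ?_) i
    · simpa using ha i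
    · simpa using hb i
  · rw [Fin.sum_univ_add]; simp [hs, ht]
  · intro i
    refine Fin.addCases (fun i => ?_) (fun i => ?_) i
    · simpa using hf i
    · simpa using hg i
  · have : (fun i => Fin.append φ ψ i (Fin.append a b i)) =
        Fin.append (fun i => φ i (a i)) (fun i => ψ i (b i)) := by
      funext i
      refine Fin.addCases (fun i => ?_) (fun i => ?_) i
      · simp
      · simp
    rw [this, List.ofFn_fin_append, List.foldl_append]
    exact (key _ (List.foldl (fun g f => f ∘ g) id (List.ofFn fun i => φ i (a i)))).symm

lemma Reachable_flow {Ham : U → Phase d → ℝ} {τ : ℝ} (hτ : 0 ≤ τ) (u : U)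
    {φ : ℝ → Phase d → Phase d} (hφ : IsFlowOf (hamVF (Ham u)) φ) :
    Reachable Ham τ (φ τ) :=
  ⟨1, fun _ => τ, fun _ => u, fun _ => φ, fun _ => hτ, by simp, fun _ => hφ, by
    simp⟩

/-- Approximately reachable in time (essentially) at most `T`. -/
def ARch (Ham : U → Phase d → ℝ) (T : ℝ) (Ψ : Phase d → Phase d) : Prop :=
  ContDiff ℝ ∞ Ψ ∧ ∀ ε > 0, ∀ S : Set (Phase d), IsCompact S → ∀ ℓ : ℕ,
    ∃ τ ∈ Icc (0:ℝ) (T + ε), ∃ Φ, ContDiff ℝ ∞ Φ ∧ Reachable Ham τ Φ ∧ CloseG ℓ S ε Φ Ψ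

variable {Ham : U → Phase d → ℝ}

lemma ARch.small {Ψ : Phase d → Phase d} (h : ARch Ham 0 Ψ) : SmallTimeReachable Ham Ψ := by
  intro ε hε S hS ℓ
  obtain ⟨τ, hτ, Φ, -, h1, h2⟩ := h.2 ε hε S hS ℓ
  exact ⟨τ, by simpa using hτ, Φ, h1, h2⟩

lemma ARch_exact {τ T : ℝ} {Φ : Phase d → Phase d} (h0 : 0 ≤ τ) (hT : τ ≤ T)
    (hs : ContDiff ℝ ∞ Φ) (h : Reachable Ham τ Φ) : ARch Ham T Φ := by
  refine ⟨hs, fun ε hε S hS ℓ => ⟨τ, ⟨h0, by linarith⟩, Φ, hs, h, fun j hj x hx => ?_⟩⟩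
  rw [iteratedFDeriv_sub_smooth hs hs]
  simpa using hε

lemma ARch.lim {ι : Type} {l : Filter ι} [l.NeBot] {T : ι → ℝ} {T₀ : ℝ}
    {F : ι → Phase d → Phase d} {f : Phase d → Phase d} (h : ∀ᶠ i in l, ARch Ham (T i) (F i))
    (hT : Tendsto T l (𝓝 T₀)) (hc : Conv l F f) : ARch Ham T₀ f := by
  refine ⟨hc.sf, fun ε hε S hS ℓ => ?_⟩
  have e2 : 0 < ε / 2 := by linarith
  have h3 : ∀ᶠ i in l, T i < T₀ + ε / 2 := hT.eventually (gt_mem_nhds (by linarith))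
  obtain ⟨i, h1, h2, h3, h4⟩ := (h.and ((hc.close ℓ hS e2).and (h3.and hc.sF))).exists
  obtain ⟨τ, hτ, Φ, s, r, c⟩ := h1.2 (ε / 2) e2 S hS ℓ
  refine ⟨τ, ⟨hτ.1, by linarith [hτ.2]⟩, Φ, s, r, ?_⟩
  have := c.trans s h4 hc.sf h2
  rwa [add_halves] at this

lemma ARch.seq {T : ℝ} {Ψ : Phase d → Phase d} (h : ARch Ham T Ψ) :
    ∃ Φ : ℕ → Phase d → Phase d, (∀ n, ContDiff ℝ ∞ (Φ n)) ∧
      (∀ n : ℕ, ∃ τ ∈ Icc (0:ℝ) (T + 1 / ((n:ℝ) + 1)), Reachable Ham τ (Φ n)) ∧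
      Conv atTop Φ Ψ := by
  have := fun n : ℕ => h.2 (1 / ((n:ℝ) + 1)) (by positivity) (Metric.closedBall 0 (n:ℝ))
    (isCompact_closedBall _ _) n
  choose τ hτ Φ hs hr hc using this
  exact ⟨Φ, hs, fun n => ⟨τ n, hτ n, hr n⟩, Conv_of_close hs h.1 hc⟩

lemma ARch.comp {T₁ T₂ : ℝ} {Ψ₁ Ψ₂ : Phase d → Phase d} (h2 : ARch Ham T₂ Ψ₂)
    (h1 : ARch Ham T₁ Ψ₁) : ARch Ham (T₁ + T₂) (fun x => Ψ₂ (Ψ₁ x)) := by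
  obtain ⟨Φ₁, s1, r1, c1⟩ := h1.seq
  obtain ⟨Φ₂, s2, r2, c2⟩ := h2.seq
  refine ARch.lim (l := atTop)
    (T := fun n : ℕ => (T₁ + 1 / ((n:ℝ) + 1)) + (T₂ + 1 / ((n:ℝ) + 1)))
    (F := fun n x => Φ₂ n (Φ₁ n x)) (Eventually.of_forall fun n => ?_) ?_ (c2.comp c1)
  · obtain ⟨τ, hτ, hr⟩ := r1 n
    obtain ⟨σ, hσ, hr'⟩ := r2 n
    exact ARch_exact (add_nonneg hτ.1 hσ.1) (add_le_add hτ.2 hσ.2) ((s2 n).comp (s1 n))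
      (hr.comp hr')
  · have := (tendsto_one_div_add_atTop_nhds_zero_nat (𝕜 := ℝ))
    simpa using (tendsto_const_nhds (x := T₁)|>.add this).add
      (tendsto_const_nhds (x := T₂)|>.add this)

lemma ARch_id : ARch Ham 0 (fun x => x) :=
  ARch_exact le_rfl le_rfl contDiff_id ⟨0, fun _ => 0, fun i => i.elim0, fun i => i.elim0,
    fun i => i.elim0, by simp, fun i => i.elim0, by simp; rfl⟩

end reach

section flow
open Set Filter Topology
open scoped ContDiff NNReal Manifold

lemma exists_global_curve {E : Type} [NormedAddCommGroup E] [NormedSpace ℝ E] [CompleteSpace E]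
    (X : E → E) (hX : ContDiff ℝ 1 X) (K : ℝ≥0) (hK : LipschitzWith K X) (x : E) :
    ∃ γ : ℝ → E, γ 0 = x ∧ ∀ t, HasDerivAt γ (X (γ t)) t := by
  have hm : ContMDiff 𝓘(ℝ, E) 𝓘(ℝ, E).tangent 1
      (fun x ↦ (⟨x, X x⟩ : TangentBundle 𝓘(ℝ, E) E)) :=
    contMDiff_vectorSpace_iff_contDiff.2 hX
  have hε : (0:ℝ) < 1 / (K + 1) := by positivity
  have key := exists_isMIntegralCurve_of_isMIntegralCurveOn (I := 𝓘(ℝ, E)) (M := E) (v := X) hm hε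
  have hloc : ∀ x : E, ∃ γ : ℝ → E, γ 0 = x ∧
      IsMIntegralCurveOn (I := 𝓘(ℝ, E)) γ X (Ioo (-(1 / ((K:ℝ) + 1))) (1 / ((K:ℝ) + 1))) := by
    intro x
    have hp : IsPicardLindelof (fun _ => X)
        (⟨0, by constructor <;> linarith⟩ : Icc (-(1 / ((K:ℝ) + 1))) (1 / ((K:ℝ) + 1))) x
        (‖X x‖₊ + 1) 0 ((K + 1) * (‖X x‖₊ + 1)) K := by
      apply IsPicardLindelof.of_time_independent
      · intro y hy
        have := hK.dist_le_mul y x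
        have h2 : dist y x ≤ ‖X x‖ + 1 := by simpa using hy
        have h3 : ‖X y‖ ≤ ‖X y - X x‖ + ‖X x‖ := by
          simpa using norm_add_le (X y - X x) (X x)
        rw [dist_eq_norm] at this
        push_cast
        have : (K:ℝ) * dist y x ≤ K * (‖X x‖ + 1) := by gcongr
        nlinarith [norm_nonneg (X x), K.2]
      · exact hK.lipschitzOnWith
      · have : (0:ℝ) < K + 1 := by positivity
        simp
        field_simp
        rfl
    obtain ⟨α, h0, h⟩ := hp.exists_eq_forall_mem_Icc_hasDerivWithinAt₀
    refine ⟨α, h0, fun t ht => ?_⟩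
    have := (h t ⟨ht.1.le, ht.2.le⟩).mono Ioo_subset_Icc_self
    exact this.hasFDerivWithinAt.hasMFDerivWithinAt
  obtain ⟨γ, h0, h⟩ := key hloc x
  refine ⟨γ, h0, fun t => ?_⟩
  have h1 : HasFDerivAt γ (ContinuousLinearMap.smulRight (1 : ℝ →L[ℝ] ℝ) (X (γ t))) t :=
    (h t).hasFDerivAt
  have h2 := h1.hasDerivAt
  rwa [ContinuousLinearMap.smulRight_apply, ContinuousLinearMap.one_apply, one_smul] at h2

lemma exists_flow {d : ℕ} (X : Phase d → Phase d) (hX : ContDiff ℝ 1 X) (K : ℝ≥0)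
    (hK : LipschitzWith K X) : ∃ φ, IsFlowOf X φ := by
  choose γ h0 h using exists_global_curve X hX K hK
  exact ⟨fun t x => γ x t, h0, fun x t => h x t⟩
end flow

section ham
open Set Filter Topology
open scoped ContDiff NNReal
variable {d : ℕ}

/-- covector to vector -/
noncomputable def toVec (d : ℕ) : ((Fin d → ℝ) →L[ℝ] ℝ) →L[ℝ] (Fin d → ℝ) :=
  ContinuousLinearMap.pi fun i => ContinuousLinearMap.apply ℝ ℝ (Pi.single i 1)

/-- gradient -/
noncomputable def gr (f : (Fin d → ℝ) → ℝ) (q : Fin d → ℝ) : Fin d → ℝ :=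
  toVec d (fderiv ℝ f q)

lemma gr_apply (f : (Fin d → ℝ) → ℝ) (q : Fin d → ℝ) (i : Fin d) :
    gr f q i = fderiv ℝ f q (Pi.single i 1) := rfl

lemma gr_smooth {f : (Fin d → ℝ) → ℝ} (hf : ContDiff ℝ ∞ f) : ContDiff ℝ ∞ (gr f) :=
  (toVec d).contDiff.comp (hf.fderiv_right (by simp))

lemma toVec_norm (v : (Fin d → ℝ) →L[ℝ] ℝ) : ‖toVec d v‖ ≤ ‖v‖ := by
  rw [pi_norm_le_iff_of_nonneg (norm_nonneg _)]
  intro i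
  have := v.le_opNorm (Pi.single i 1)
  rwa [Pi.norm_single, norm_one, mul_one] at this

lemma gr_lip {f : (Fin d → ℝ) → ℝ} {L : ℝ≥0} (hf : LipschitzWith L (fderiv ℝ f)) (q q') :
    ‖gr f q - gr f q'‖ ≤ L * ‖q - q'‖ := by
  rw [gr, gr, ← map_sub]
  refine (toVec_norm _).trans ?_
  simpa [dist_eq_norm] using hf.dist_le_mul q q'

lemma vshear_eq (f : (Fin d → ℝ) → ℝ) : vshear f = fun x => (x.1, x.2 - gr f x.1) := rfl

lemma gr_add {f g : (Fin d → ℝ) → ℝ} (hf : ContDiff ℝ ∞ f) (hg : ContDiff ℝ ∞ g) (q) :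
    gr (fun q => f q + g q) q = gr f q + gr g q := by
  rw [gr, gr, gr, ← map_add]
  congr 1
  exact fderiv_add (hf.differentiable (by simp) q) (hg.differentiable (by simp) q)

lemma gr_smul {f : (Fin d → ℝ) → ℝ} (hf : ContDiff ℝ ∞ f) (c : ℝ) (q) :
    gr (fun q => c * f q) q = c • gr f q := by
  rw [gr, gr, ← map_smul]
  congr 1
  exact fderiv_const_mul (hf.differentiable (by simp) q) c

/-- Gaussian -/
noncomputable def gau (q : Fin d → ℝ) : ℝ := Real.exp (-(∑ i, (q i) ^ 2) / 2)

lemma gau_smooth : ContDiff ℝ ∞ (gau (d := d)) := by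
  unfold gau; fun_prop

lemma gau_hasFDerivAt (q : Fin d → ℝ) :
    HasFDerivAt gau (-(gau q) • ∑ j, q j • (ContinuousLinearMap.proj j : (Fin d → ℝ) →L[ℝ] ℝ)) q := by
  have h1 : ∀ j : Fin d, HasFDerivAt (fun q : Fin d → ℝ => q j)
      (ContinuousLinearMap.proj j : (Fin d → ℝ) →L[ℝ] ℝ) q := fun j => hasFDerivAt_apply j q
  have h2 := (HasFDerivAt.fun_sum (u := Finset.univ) fun j _ => (h1 j).pow 2)
  have h3 := ((h2.neg.mul_const (1/2:ℝ))).exp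
  have h4 : gau = fun x : Fin d → ℝ => Real.exp ((-fun y : Fin d → ℝ => ∑ i, y i ^ 2) x * (1 / 2)) := by
    funext q; simp [gau, div_eq_mul_inv]
  have h5 := h3.congr_fderiv (g' := -(gau q) • ∑ j, q j •
      (ContinuousLinearMap.proj j : (Fin d → ℝ) →L[ℝ] ℝ)) (by
    ext v
    simp [gau, Finset.mul_sum, div_eq_mul_inv]
    try refine Finset.sum_congr rfl fun j _ => ?_
    try ring)
  rwa [← h4] at h5

lemma gau_gr (q : Fin d → ℝ) (i : Fin d) : gr gau q i = -(q i * gau q) := by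
  rw [gr_apply, (gau_hasFDerivAt q).fderiv]
  simp [Pi.single_apply, mul_comm]

lemma gau_le (q : Fin d → ℝ) : gau q ≤ 1 := by
  unfold gau
  rw [Real.exp_le_one_iff]
  have : 0 ≤ ∑ i, (q i) ^ 2 := by positivity
  linarith

lemma gau_bd (q : Fin d → ℝ) (i j : Fin d) : |q i * q j| * gau q ≤ 1 * 2 := by
  have hi : (q i)^2 ≤ ∑ i, (q i) ^ 2 :=
    Finset.single_le_sum (f := fun i => (q i)^2) (fun i _ => sq_nonneg _) (Finset.mem_univ i)
  have hj : (q j)^2 ≤ ∑ i, (q i) ^ 2 :=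
    Finset.single_le_sum (f := fun i => (q i)^2) (fun i _ => sq_nonneg _) (Finset.mem_univ j)
  have hs : |q i * q j| ≤ ∑ i, (q i) ^ 2 := by
    rw [abs_mul]
    nlinarith [sq_abs (q i), sq_abs (q j), sq_nonneg (|q i| - |q j|)]
  set s := ∑ i, (q i) ^ 2
  have he : gau q * Real.exp (s / 2) = 1 := by
    unfold gau; rw [← Real.exp_add]; simp [s]; ring
  have h1 := Real.add_one_le_exp (s / 2)
  have hg : 0 < gau q := Real.exp_pos _
  nlinarith

lemma gau_gr_lip (q q' : Fin d → ℝ) :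
    ‖gr gau q - gr gau q'‖ ≤ (1 + 2 * d : ℝ≥0) * ‖q - q'‖ := by
  rw [pi_norm_le_iff_of_nonneg (by positivity)]
  intro i
  have hd : ∀ q : Fin d → ℝ, HasFDerivAt (fun q => gr gau q i)
      (-(q i • (-(gau q) • ∑ j, q j • (ContinuousLinearMap.proj j : (Fin d → ℝ) →L[ℝ] ℝ))
        + gau q • (ContinuousLinearMap.proj i : (Fin d → ℝ) →L[ℝ] ℝ))) q := by
    intro q
    simp only [gau_gr]
    exact ((hasFDerivAt_apply i q).mul (gau_hasFDerivAt q)).neg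
  have hb : ∀ q : Fin d → ℝ, ‖fderiv ℝ (fun q => gr gau q i) q‖₊ ≤ (1 + 2 * d : ℝ≥0) := by
    intro q
    rw [(hd q).fderiv, ← NNReal.coe_le_coe, coe_nnnorm, norm_neg]
    refine ContinuousLinearMap.opNorm_le_bound _ (by positivity) fun v => ?_
    have hg : 0 < gau q := Real.exp_pos _
    have e : (q i • (-(gau q) • ∑ j, q j • (ContinuousLinearMap.proj j : (Fin d → ℝ) →L[ℝ] ℝ))
        + gau q • (ContinuousLinearMap.proj i : (Fin d → ℝ) →L[ℝ] ℝ)) v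
        = gau q * v i - ∑ j, (q i * q j) * gau q * v j := by
      simp [Finset.mul_sum]
      rw [add_comm, sub_eq_add_neg]
      congr 2
      refine Finset.sum_congr rfl fun j _ => by ring
    rw [e]
    have b1 : ‖gau q * v i‖ ≤ 1 * ‖v‖ := by
      rw [norm_mul]
      refine mul_le_mul ?_ (norm_le_pi_norm v i) (norm_nonneg _) zero_le_one
      rw [Real.norm_of_nonneg hg.le]; exact gau_le q
    have b2 : ‖∑ j, (q i * q j) * gau q * v j‖ ≤ ∑ j : Fin d, 2 * ‖v‖ := by
      refine norm_sum_le_of_le _ fun j _ => ?_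
      rw [norm_mul, norm_mul, Real.norm_of_nonneg hg.le]
      have := gau_bd q i j
      rw [one_mul] at this
      exact mul_le_mul this (norm_le_pi_norm v j) (norm_nonneg _) (by norm_num)
    rw [Finset.sum_const, Finset.card_univ, Fintype.card_fin, nsmul_eq_mul] at b2
    refine (norm_sub_le _ _).trans ?_
    push_cast
    linarith
  have := lipschitzWith_of_nnnorm_fderiv_le (fun q => (hd q).differentiableAt) hb
  simpa [dist_eq_norm] using this.dist_le_mul q q'

/-- control potential -/
noncomputable def pot (u : (Fin d → ℝ) × ℝ) (q : Fin d → ℝ) : ℝ :=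
  (∑ j, u.1 j * q j) + u.2 * gau q

lemma pot_smooth (u : (Fin d → ℝ) × ℝ) : ContDiff ℝ ∞ (pot u) := by
  unfold pot
  have := gau_smooth (d := d)
  fun_prop

lemma pot_gr (u : (Fin d → ℝ) × ℝ) (q) : gr (pot u) q = u.1 + u.2 • gr gau q := by
  have h1 : ContDiff ℝ ∞ (fun q : Fin d → ℝ => ∑ j, u.1 j * q j) := by fun_prop
  have h2 : ContDiff ℝ ∞ (fun q : Fin d → ℝ => u.2 * gau q) := contDiff_const.mul gau_smooth
  have := gr_add h1 h2 q
  unfold pot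
  rw [this, gr_smul gau_smooth]
  congr 1
  funext i
  rw [gr_apply]
  have h3 : HasFDerivAt (fun q : Fin d → ℝ => ∑ j, u.1 j * q j)
      (∑ j, u.1 j • (ContinuousLinearMap.proj j : (Fin d → ℝ) →L[ℝ] ℝ)) q :=
    HasFDerivAt.fun_sum fun j _ => (hasFDerivAt_apply j q).const_mul (u.1 j)
  rw [h3.fderiv]
  simp [Pi.single_apply]

lemma pot_gr_lip (u : (Fin d → ℝ) × ℝ) (q q') :
    ‖gr (pot u) q - gr (pot u) q'‖ ≤ |u.2| * (1 + 2 * d) * ‖q - q'‖ := by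
  rw [pot_gr, pot_gr, add_sub_add_left_eq_sub, ← smul_sub, norm_smul, mul_assoc, Real.norm_eq_abs]
  gcongr
  simpa using gau_gr_lip q q'

lemma ham_eq {V0 : (Fin d → ℝ) → ℝ} (hV : ContDiff ℝ ∞ V0) (u : (Fin d → ℝ) × ℝ) (x : Phase d) :
    hamVF (eucHam V0 u) x = (x.2, - gr V0 x.1 - gr (pot u) x.1) := by
  have e : eucHam V0 u = fun x => (∑ i, (x.2 i) ^ 2) / 2 + (V0 x.1 + pot u x.1) := by
    funext x; simp only [eucHam, pot, gau]; ring
  have hW : HasFDerivAt (fun q => V0 q + pot u q) (fderiv ℝ V0 x.1 + fderiv ℝ (pot u) x.1) x.1 :=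
    (hV.differentiable (by simp) x.1).hasFDerivAt.add
      ((pot_smooth u).differentiable (by simp) x.1).hasFDerivAt
  have hT : HasFDerivAt (fun p : Fin d → ℝ => (∑ i, (p i) ^ 2) / 2)
      (∑ i, x.2 i • (ContinuousLinearMap.proj i : (Fin d → ℝ) →L[ℝ] ℝ)) x.2 := by
    have h2 := (HasFDerivAt.fun_sum (u := Finset.univ) fun j _ =>
      (hasFDerivAt_apply (𝕜 := ℝ) (F' := fun _ : Fin d => ℝ) j x.2).pow 2)
    have h3 := h2.mul_const (2⁻¹:ℝ)
    simp only [div_eq_mul_inv]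
    refine h3.congr_fderiv ?_
    ext v
    simp [Finset.mul_sum]
    refine Finset.sum_congr rfl fun j _ => by ring
  have h1 := (hT.comp x hasFDerivAt_snd).add (hW.comp x hasFDerivAt_fst)
  have e2 : eucHam V0 u = ((fun p : Fin d → ℝ => (∑ i, p i ^ 2) / 2) ∘ Prod.snd +
      (fun q => V0 q + pot u q) ∘ Prod.fst) := e
  rw [← e2] at h1
  unfold hamVF
  rw [h1.fderiv]
  refine Prod.ext ?_ ?_
  · funext i
    simp [Pi.single_apply]
  · funext i
    simp [gr_apply]
    ring
end ham

section flowlem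
open Set Filter Topology
open scoped ContDiff NNReal
variable {d : ℕ}

lemma exists_ham_flow {V0 : (Fin d → ℝ) → ℝ} (hV : ContDiff ℝ ∞ V0) {L : ℝ≥0}
    (hL : LipschitzWith L (fderiv ℝ V0)) (u : (Fin d → ℝ) × ℝ) :
    ∃ φ, IsFlowOf (hamVF (eucHam V0 u)) φ := by
  have e : hamVF (eucHam V0 u) = fun x => (x.2, - gr V0 x.1 - gr (pot u) x.1) :=
    funext (ham_eq hV u)
  have s1 := gr_smooth hV
  have s2 := gr_smooth (pot_smooth u)
  have hs : ContDiff ℝ ∞ (hamVF (eucHam V0 u)) := by rw [e]; fun_prop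
  refine exists_flow _ (hs.of_le (by exact_mod_cast le_top)) (1 + L + ‖u.2‖₊ * (1 + 2 * d)) ?_
  refine LipschitzWith.of_dist_le_mul fun x y => ?_
  rw [e, dist_eq_norm, dist_eq_norm]
  have n1 : ‖x.1 - y.1‖ ≤ ‖x - y‖ := norm_fst_le (x - y)
  have n2 : ‖x.2 - y.2‖ ≤ ‖x - y‖ := norm_snd_le (x - y)
  have a1 := gr_lip hL x.1 y.1
  have a2 := pot_gr_lip u x.1 y.1
  have c1 : (L:ℝ) * ‖x.1 - y.1‖ ≤ L * ‖x - y‖ := by gcongr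
  have c2 : |u.2| * (1 + 2 * d) * ‖x.1 - y.1‖ ≤ |u.2| * (1 + 2 * d) * ‖x - y‖ := by gcongr
  have c3 : 0 ≤ (L:ℝ) * ‖x - y‖ := by positivity
  have c4 : 0 ≤ |u.2| * (1 + 2 * d) * ‖x - y‖ := by positivity
  have c5 := norm_nonneg (x - y)
  simp only [Prod.mk_sub_mk, Prod.norm_mk]
  push_cast
  rw [Real.norm_eq_abs]
  refine max_le (by nlinarith) ?_
  have : - gr V0 x.1 - gr (pot u) x.1 - (- gr V0 y.1 - gr (pot u) y.1)
      = -(gr V0 x.1 - gr V0 y.1) - (gr (pot u) x.1 - gr (pot u) y.1) := by abel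
  rw [this]
  refine (norm_sub_le _ _).trans ?_
  rw [norm_neg]
  nlinarith

/-- Time one map of a family of vector fields. -/
lemma family_flow (a : Fin d → ℝ) (A B : (Fin d → ℝ) → (Fin d → ℝ)) (hA : ContDiff ℝ ∞ A)
    (hB : ContDiff ℝ ∞ B) (L : ℝ≥0) (hLA : ∀ q q', ‖A q - A q'‖ ≤ L * ‖q - q'‖)
    (hLB : ∀ q q', ‖B q - B q'‖ ≤ 1 / 2 * ‖q - q'‖) :
    ∃ U : Set ℝ, IsOpen U ∧ (0:ℝ) ∈ U ∧ ∃ W : ℝ × Phase d → Phase d,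
      ContDiffOn ℝ ∞ W (U ×ˢ univ) ∧
      ∀ δ ∈ U, ∀ γ : ℝ → Phase d,
        (∀ s, HasDerivAt γ (a + δ • (γ s).2, - δ • A (γ s).1 - B (γ s).1) s) →
        W (δ, γ 0) = γ 1 := by
  have hr : (0:ℝ) < 1 / (4 * (L + 1)) := by positivity
  let X : (ℝ × Phase d) × ℝ × Phase d → Phase d := fun z =>
    (a + z.1.1 • (z.1.2.2 + z.2.2.2), - z.1.1 • A (z.1.2.1 + z.2.2.1) - B (z.1.2.1 + z.2.2.1))
  have hX : ContDiff ℝ ∞ X := by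
    simp only [X]; fun_prop
  obtain ⟨Y, hY, hY2⟩ := param_ode X hX (Metric.ball (0:ℝ) (1 / (4 * (L + 1))) ×ˢ univ)
    (Metric.isOpen_ball.prod isOpen_univ) (3/4) (by
      rw [← NNReal.coe_lt_coe]; push_cast; norm_num) (by
    rintro ⟨δ, x⟩ ⟨hδ, -⟩ s - y y'
    simp only [Metric.mem_ball, dist_zero_right, Real.norm_eq_abs] at hδ
    have n1 : ‖y.1 - y'.1‖ ≤ ‖y - y'‖ := norm_fst_le (y - y')
    have n2 : ‖y.2 - y'.2‖ ≤ ‖y - y'‖ := norm_snd_le (y - y')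
    have a1 := hLA (x.1 + y.1) (x.1 + y'.1)
    have a2 := hLB (x.1 + y.1) (x.1 + y'.1)
    rw [add_sub_add_left_eq_sub] at a1 a2
    have hδ2 : |δ| * (L + 1) ≤ 1 / 4 := by
      rw [lt_div_iff₀ (by positivity)] at hδ; linarith
    have hδ3 : |δ| ≤ 1 / 4 := by nlinarith [abs_nonneg δ, L.2]
    have hδ4 : |δ| * L ≤ 1 / 4 := by nlinarith [abs_nonneg δ, L.2]
    have e : X ((δ, x), s, y) - X ((δ, x), s, y') = (δ • (y.2 - y'.2),
        -δ • (A (x.1 + y.1) - A (x.1 + y'.1)) - (B (x.1 + y.1) - B (x.1 + y'.1))) := by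
      simp only [X, Prod.mk_sub_mk, smul_sub, smul_add]
      congr 1 <;> abel
    rw [e, Prod.norm_mk, norm_smul]
    have c5 := norm_nonneg (y - y')
    push_cast
    refine max_le ?_ ((norm_sub_le _ _).trans ?_)
    · rw [Real.norm_eq_abs]
      nlinarith [abs_nonneg δ]
    · rw [norm_smul, norm_neg, Real.norm_eq_abs]
      have : |δ| * ‖A (x.1 + y.1) - A (x.1 + y'.1)‖ ≤ |δ| * (L * ‖y - y'‖) := by
        gcongr
        exact a1.trans (by gcongr)
      nlinarith)
  refine ⟨Metric.ball (0:ℝ) (1 / (4 * (L + 1))), Metric.isOpen_ball, Metric.mem_ball_self hr,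
    fun z => z.2 + Y z, contDiff_snd.contDiffOn.add hY, fun δ hδ γ hγ => ?_⟩
  have := hY2 (δ, γ 0) ⟨hδ, mem_univ _⟩ (fun s => γ s - γ 0) (by simp) (fun s _ => by
    simp only [X, Prod.fst_sub, Prod.snd_sub, add_sub_cancel]
    exact (hγ s).sub_const (γ 0))
  simp [this]

lemma quad_flow (A : (Fin d → ℝ) → (Fin d → ℝ)) (hA : ContDiff ℝ ∞ A)
    (L : ℝ≥0) (hLA : ∀ q q', ‖A q - A q'‖ ≤ L * ‖q - q'‖) :
    ∃ U : Set ℝ, IsOpen U ∧ (0:ℝ) ∈ U ∧ ∃ Y : ℝ × Phase d → Phase d,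
      ContDiffOn ℝ ∞ Y (U ×ˢ univ) ∧
      ∀ δ ∈ U, ∀ x : Phase d, ∀ γ : ℝ → Phase d, γ 0 = 0 →
        (∀ s, HasDerivAt γ ((1/2:ℝ) • (γ s).2,
          - A ((1 - s) • x.1 + s • x.2 + (2 * δ^2) • (γ s).1)) s) →
        Y (δ, x) = γ 1 := by
  have hr : (0:ℝ) < 1 / (4 * (L + 1)) := by positivity
  let X : (ℝ × Phase d) × ℝ × Phase d → Phase d := fun z =>
    ((1/2:ℝ) • z.2.2.2,
      - A ((1 - z.2.1) • z.1.2.1 + z.2.1 • z.1.2.2 + (2 * z.1.1 ^ 2) • z.2.2.1))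
  have hX : ContDiff ℝ ∞ X := by
    simp only [X]; fun_prop
  obtain ⟨Y, hY, hY2⟩ := param_ode X hX (Metric.ball (0:ℝ) (1 / (4 * (L + 1))) ×ˢ univ)
    (Metric.isOpen_ball.prod isOpen_univ) (1/2) (by
      rw [← NNReal.coe_lt_coe]; push_cast; norm_num) (by
    rintro ⟨δ, x⟩ ⟨hδ, -⟩ s - y y'
    simp only [Metric.mem_ball, dist_zero_right, Real.norm_eq_abs] at hδ
    have n1 : ‖y.1 - y'.1‖ ≤ ‖y - y'‖ := norm_fst_le (y - y')
    have n2 : ‖y.2 - y'.2‖ ≤ ‖y - y'‖ := norm_snd_le (y - y')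
    have a1 := hLA ((1 - s) • x.1 + s • x.2 + (2 * δ^2) • y.1)
      ((1 - s) • x.1 + s • x.2 + (2 * δ^2) • y'.1)
    rw [add_sub_add_left_eq_sub, ← smul_sub, norm_smul] at a1
    have hδ2 : |δ| * (L + 1) ≤ 1 / 4 := by
      rw [lt_div_iff₀ (by positivity)] at hδ; linarith
    have hδ3 : |δ| ≤ 1 / 4 := by nlinarith [abs_nonneg δ, L.2]
    have hδ4 : |δ| * L ≤ 1 / 4 := by nlinarith [abs_nonneg δ, L.2]
    have hδ5 : L * ‖2 * δ ^ 2‖ ≤ 1 / 2 := by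
      rw [Real.norm_of_nonneg (by positivity), ← sq_abs]
      nlinarith [abs_nonneg δ, L.2]
    have c5 := norm_nonneg (y - y')
    simp only [X, Prod.mk_sub_mk, Prod.norm_mk]
    push_cast
    refine max_le ?_ ?_
    · rw [← smul_sub, norm_smul, Real.norm_of_nonneg (by norm_num)]
      linarith
    · rw [neg_sub_neg, ← norm_neg, neg_sub]
      refine a1.trans ?_
      rw [← mul_assoc]
      gcongr)
  refine ⟨Metric.ball (0:ℝ) (1 / (4 * (L + 1))), Metric.isOpen_ball, Metric.mem_ball_self hr,
    Y, hY, fun δ hδ x γ h0 hγ => ?_⟩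
  exact hY2 (δ, x) ⟨hδ, mem_univ _⟩ γ h0 (fun s _ => by simpa [X] using hγ s)

end flowlem

section shears
open Set Filter Topology
open scoped ContDiff NNReal
variable {d : ℕ}

lemma HasDerivAt.phase {γ : ℝ → Phase d} {v : Phase d} {t : ℝ} :
    HasDerivAt γ v t ↔ HasDerivAt (fun s => (γ s).1) v.1 t ∧ HasDerivAt (fun s => (γ s).2) v.2 t :=
  ⟨fun h => ⟨h.fst, h.snd⟩, fun h => h.1.prodMk h.2⟩

lemma vshear_smooth {f : (Fin d → ℝ) → ℝ} (hf : ContDiff ℝ ∞ f) : ContDiff ℝ ∞ (vshear f) := by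
  have := gr_smooth hf
  rw [vshear_eq]; fun_prop

lemma flow_rescale {V0 : (Fin d → ℝ) → ℝ} (hV : ContDiff ℝ ∞ V0) {u : (Fin d → ℝ) × ℝ}
    {φ : ℝ → Phase d → Phase d} (hφ : IsFlowOf (hamVF (eucHam V0 u)) φ) (δ : ℝ) (x : Phase d)
    (s : ℝ) : HasDerivAt (fun s => φ (δ * s) x)
      (δ • (φ (δ * s) x).2, δ • (- gr V0 (φ (δ * s) x).1 - gr (pot u) (φ (δ * s) x).1)) s := by
  have h1 := hφ.2 x (δ * s)
  rw [ham_eq hV] at h1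
  have h2 : HasDerivAt (fun s : ℝ => δ * s) δ s := by
    simpa using (hasDerivAt_id s).const_mul δ
  exact h1.scomp s h2

lemma vshear_pot_small {V0 : (Fin d → ℝ) → ℝ} (hV : ContDiff ℝ ∞ V0) {L : ℝ≥0}
    (hL : LipschitzWith L (fderiv ℝ V0)) (u : (Fin d → ℝ) × ℝ)
    (hu : |u.2| * (1 + 2 * d) ≤ 1 / 2) : ARch (eucHam V0) 0 (vshear (pot u)) := by
  obtain ⟨U, hU, h0, W, hW, hW2⟩ := family_flow 0 (gr V0) (gr (pot u)) (gr_smooth hV)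
    (gr_smooth (pot_smooth u)) L (gr_lip hL) (fun q q' => (pot_gr_lip u q q').trans (by gcongr))
  have hc := (Conv_of_smooth hU h0 hW).mono (nhdsWithin_le_nhds (s := Ioi (0:ℝ)))
  have e0 : (fun x => W (0, x)) = vshear (pot u) := by
    funext x
    have := hW2 0 h0 (fun s => (x.1, x.2 - s • gr (pot u) x.1)) (fun s => by
      rw [HasDerivAt.phase]
      refine ⟨by simpa using hasDerivAt_const s x.1, ?_⟩
      simpa using ((hasDerivAt_id s).smul_const (gr (pot u) x.1)).const_sub x.2)
    simpa [vshear_eq] using this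
  rw [e0] at hc
  refine ARch.lim (T := fun δ : ℝ => δ) ?_ (tendsto_nhdsWithin_of_tendsto_nhds tendsto_id) hc
  filter_upwards [hc.sF, self_mem_nhdsWithin, nhdsWithin_le_nhds (hU.mem_nhds h0)] with δ s hδ hδU
  have hδ' : (0:ℝ) < δ := hδ
  obtain ⟨φ, hφ⟩ := exists_ham_flow hV hL (δ⁻¹ • u)
  refine ARch_exact hδ'.le le_rfl s ?_
  have : (fun x => W (δ, x)) = φ δ := by
    funext x
    have := hW2 δ hδU (fun s => φ (δ * s) x) (fun s => by
      have := flow_rescale hV hφ δ x s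
      convert this using 2
      · simp
      · rw [pot_gr, pot_gr, smul_sub]
        simp [smul_smul, hδ'.ne']
        )
    simpa [hφ.1] using this
  rw [this]
  exact Reachable_flow hδ'.le _ hφ

lemma translation {V0 : (Fin d → ℝ) → ℝ} (hV : ContDiff ℝ ∞ V0) {L : ℝ≥0}
    (hL : LipschitzWith L (fderiv ℝ V0)) (a : Fin d → ℝ) :
    ARch (eucHam V0) 0 (fun x => (x.1 + a, x.2)) := by
  obtain ⟨U, hU, h0, W, hW, hW2⟩ := family_flow a (gr V0) 0 (gr_smooth hV)
    contDiff_const L (gr_lip hL) (fun q q' => by simp)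
  have hc := (Conv_of_smooth hU h0 hW).mono (nhdsWithin_le_nhds (s := Ioi (0:ℝ)))
  have e0 : (fun x => W (0, x)) = (fun x => (x.1 + a, x.2)) := by
    funext x
    have := hW2 0 h0 (fun s => (x.1 + s • a, x.2)) (fun s => by
      rw [HasDerivAt.phase]
      refine ⟨?_, by simpa using hasDerivAt_const s x.2⟩
      simpa using ((hasDerivAt_id s).smul_const a).const_add x.1)
    simpa using this
  rw [e0] at hc
  refine ARch.lim (T := fun δ : ℝ => δ) ?_ (tendsto_nhdsWithin_of_tendsto_nhds tendsto_id) hc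
  filter_upwards [hc.sF, self_mem_nhdsWithin, nhdsWithin_le_nhds (hU.mem_nhds h0)] with δ s hδ hδU
  have hδ' : (0:ℝ) < δ := hδ
  obtain ⟨φ, hφ⟩ := exists_ham_flow hV hL 0
  have hz : ∀ q, gr (pot (0 : (Fin d → ℝ) × ℝ)) q = 0 := fun q => by rw [pot_gr]; simp
  have key : ∀ x, W (δ, x) = ((φ δ (x.1, x.2 + δ⁻¹ • a)).1, (φ δ (x.1, x.2 + δ⁻¹ • a)).2 - δ⁻¹ • a) := by
    intro x
    have := hW2 δ hδU (fun s => φ (δ * s) (x.1, x.2 + δ⁻¹ • a) - (0, δ⁻¹ • a)) (fun s => by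
      refine ((flow_rescale hV hφ δ (x.1, x.2 + δ⁻¹ • a) s).sub_const
        (0, δ⁻¹ • a)).congr_deriv (Prod.ext ?_ ?_)
      · simp [smul_sub, smul_smul, hδ'.ne']
      · simp [hz])
    simp only [mul_zero, hφ.1, mul_one, Prod.mk_sub_mk, sub_zero, add_sub_cancel_right] at this
    rw [show x = (x.1, x.2) from rfl, this]
    exact Prod.ext (by simp) (by simp)
  have v1 : vshear (pot (-(δ⁻¹ • a), 0)) = fun x => (x.1, x.2 + δ⁻¹ • a) := by
    rw [vshear_eq]; funext x; rw [pot_gr]; simp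
  have v2 : vshear (pot (δ⁻¹ • a, 0)) = fun x => (x.1, x.2 - δ⁻¹ • a) := by
    rw [vshear_eq]; funext x; rw [pot_gr]; simp
  have r1 := vshear_pot_small hV hL (-(δ⁻¹ • a), 0) (by simp)
  have r2 := vshear_pot_small hV hL (δ⁻¹ • a, 0) (by simp)
  rw [v1] at r1
  rw [v2] at r2
  have hs : ContDiff ℝ ∞ (φ δ) := by
    have : φ δ = fun x => (fun x : Phase d => (x.1, x.2 + δ⁻¹ • a)) (W (δ, (fun x : Phase d => (x.1, x.2 - δ⁻¹ • a)) x)) := by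
      funext x
      simp [key]
    rw [this]
    exact (r1.1).comp (s.comp r2.1)
  have r3 : ARch (eucHam V0) δ (φ δ) := ARch_exact hδ'.le le_rfl hs (Reachable_flow hδ'.le _ hφ)
  have := r2.comp (r3.comp r1)
  simp only [zero_add, add_zero] at this
  convert this using 2 with x
  exact key x
end shears

section vs
open Set Filter Topology
open scoped ContDiff NNReal
variable {d : ℕ}

/-- potentials all of whose multiples have reachable shears -/
def VS (V0 : (Fin d → ℝ) → ℝ) (f : (Fin d → ℝ) → ℝ) : Prop :=
  ContDiff ℝ ∞ f ∧ ∀ c : ℝ, ARch (eucHam V0) 0 (vshear (fun q => c * f q))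

lemma vshear_add {f g : (Fin d → ℝ) → ℝ} (hf : ContDiff ℝ ∞ f) (hg : ContDiff ℝ ∞ g) :
    vshear (fun q => f q + g q) = fun x => vshear f (vshear g x) := by
  funext x
  simp only [vshear_eq, gr_add hf hg]
  congr 1
  abel

lemma vshear_conv {ι : Type} {l : Filter ι} {F : ι → (Fin d → ℝ) → ℝ} {f : (Fin d → ℝ) → ℝ}
    (h : Conv l F f) : Conv l (fun i => vshear (F i)) (vshear f) := by
  have hfst : Conv l (fun _ : ι => (Prod.fst : Phase d → (Fin d → ℝ))) Prod.fst :=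
    Conv_const contDiff_fst
  have h1 : Conv l (fun i (x : Phase d) => (x, fderiv ℝ (F i) x.1)) (fun x => (x, fderiv ℝ f x.1)) :=
    (Conv_const contDiff_id).prod (h.fderiv.comp hfst)
  have hs : ContDiff ℝ ∞ (fun z : Phase d × ((Fin d → ℝ) →L[ℝ] ℝ) => (z.1.1, z.1.2 - toVec d z.2)) := by
    have := (toVec d).contDiff (n := ∞)
    fun_prop
  exact (Conv_const hs).comp h1

variable {V0 : (Fin d → ℝ) → ℝ}

lemma VS.add {f g : (Fin d → ℝ) → ℝ} (hf : VS V0 f) (hg : VS V0 g) :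
    VS V0 (fun q => f q + g q) := by
  refine ⟨hf.1.add hg.1, fun c => ?_⟩
  have e : (fun q => c * (f q + g q)) = fun q => c * f q + c * g q := by funext q; ring
  rw [e, vshear_add (contDiff_const.mul hf.1) (contDiff_const.mul hg.1)]
  simpa using (hf.2 c).comp (hg.2 c)

lemma VS.smul {f : (Fin d → ℝ) → ℝ} (hf : VS V0 f) (b : ℝ) : VS V0 (fun q => b * f q) := by
  refine ⟨contDiff_const.mul hf.1, fun c => ?_⟩
  simpa only [← mul_assoc] using hf.2 (c * b)

lemma VS.lim {ι : Type} {l : Filter ι} [l.NeBot] {F : ι → (Fin d → ℝ) → ℝ} {f : (Fin d → ℝ) → ℝ}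
    (hc : Conv l F f) (h : ∀ᶠ i in l, VS V0 (F i)) : VS V0 f := by
  refine ⟨hc.sf, fun c => ?_⟩
  have hc' : Conv l (fun i q => c * F i q) (fun q => c * f q) :=
    (Conv_const (f := fun y : ℝ => c * y) (by fun_prop)).comp hc
  exact ARch.lim (T := fun _ => 0) (h.mono fun i hi => hi.2 c) tendsto_const_nhds
    (vshear_conv hc')

lemma VS_zero : VS V0 (fun _ => 0) := by
  refine ⟨contDiff_const, fun c => ?_⟩
  have : vshear (fun _ : Fin d → ℝ => c * (0:ℝ)) = fun x => x := by
    funext x; rw [vshear_eq]; simp [gr]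
  rw [this]; exact ARch_id

lemma VS.sum {ι : Type} (s : Finset ι) {F : ι → (Fin d → ℝ) → ℝ} (h : ∀ i ∈ s, VS V0 (F i)) :
    VS V0 (fun q => ∑ i ∈ s, F i q) := by
  classical
  induction s using Finset.induction_on with
  | empty => simpa using VS_zero
  | insert i s hi ih =>
    simp only [Finset.sum_insert hi]
    exact (h i (by simp)).add (ih fun j hj => h j (by simp [hj]))


lemma VS_gau (hV : ContDiff ℝ ∞ V0) {L : ℝ≥0} (hL : LipschitzWith L (fderiv ℝ V0)) :
    VS V0 (gau (d := d)) := by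
  refine ⟨gau_smooth, fun c => ?_⟩
  obtain ⟨n, hn⟩ := exists_nat_gt (2 * |c| * (1 + 2 * d))
  have hn0 : (0:ℝ) < n := lt_of_le_of_lt (by positivity) hn
  set b := c / n with hb
  have h1 : ARch (eucHam V0) 0 (vshear (fun q => b * gau q)) := by
    have := vshear_pot_small hV hL (0, b) (by
      simp only [hb, abs_div, Nat.abs_cast]
      rw [div_mul_eq_mul_div, div_le_iff₀ hn0]; linarith)
    convert this using 3 with q
    simp [pot]
  have h2 : ∀ m : ℕ, ARch (eucHam V0) 0 (vshear (fun q => ((m:ℝ) * b) * gau q)) := by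
    intro m
    induction m with
    | zero => simpa using (VS_zero (V0 := V0)).2 1
    | succ m ih =>
      have e : (fun q : Fin d → ℝ => (((m + 1 : ℕ) : ℝ) * b) * gau q)
          = fun q => (m * b) * gau q + b * gau q := by funext q; push_cast; ring
      rw [e, vshear_add (contDiff_const.mul gau_smooth) (contDiff_const.mul gau_smooth)]
      simpa using ih.comp h1
  have := h2 n
  rwa [hb, mul_div_cancel₀ _ hn0.ne'] at this

lemma VS.translate (hV : ContDiff ℝ ∞ V0) {L : ℝ≥0} (hL : LipschitzWith L (fderiv ℝ V0))
    {f : (Fin d → ℝ) → ℝ} (hf : VS V0 f) (a : Fin d → ℝ) : VS V0 (fun q => f (q - a)) := by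
  refine ⟨hf.1.comp (by fun_prop), fun c => ?_⟩
  have h := (translation hV hL a).comp ((hf.2 c).comp (translation hV hL (-a)))
  simp only [add_zero] at h
  convert h using 2 with x
  simp only [vshear_eq]
  have : ∀ q, gr (fun q => c * f (q - a)) q = gr (fun q => c * f q) (q - a) := by
    intro q
    rw [gr, gr, ← fderiv_comp_sub]
  simp [this, ← sub_eq_add_neg]
end vs

section narrow
open Set Filter Topology
open scoped ContDiff NNReal
variable {d : ℕ}

lemma conv_slope_exp :
    Conv (𝓝[≠] (0:ℝ)) (fun t s : ℝ => (Real.exp (t * s) - 1) / t) (fun s => s) := by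
  refine ⟨Eventually.of_forall fun t => by fun_prop, contDiff_id, fun n => ?_⟩
  have h0 : CC (𝓝[≠] (0:ℝ)) 0 (fun t s : ℝ => (Real.exp (t * s) - 1) / t) (fun s => s) := by
    rw [CC_zero]
    intro x
    have h1 : Tendsto (fun z : ℝ × ℝ => z.2 * dslope Real.exp 0 (z.1 * z.2))
        (𝓝[≠] (0:ℝ) ×ˢ 𝓝 x) (𝓝 (x * dslope Real.exp 0 0)) := by
      have a1 : Tendsto (fun z : ℝ × ℝ => z.1) (𝓝[≠] (0:ℝ) ×ˢ 𝓝 x) (𝓝 0) :=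
        (tendsto_nhdsWithin_of_tendsto_nhds tendsto_id).comp tendsto_fst
      have a2 : Tendsto (fun z : ℝ × ℝ => z.2) (𝓝[≠] (0:ℝ) ×ˢ 𝓝 x) (𝓝 x) := tendsto_snd
      have a3 := a1.mul a2
      rw [zero_mul] at a3
      have c : ContinuousAt (dslope Real.exp 0) 0 :=
        continuousAt_dslope_same.2 Real.differentiable_exp.differentiableAt
      exact a2.mul (c.tendsto.comp a3)
    rw [dslope_same, Real.deriv_exp, Real.exp_zero, mul_one] at h1
    refine h1.congr' ?_
    have : ∀ᶠ z : ℝ × ℝ in 𝓝[≠] (0:ℝ) ×ˢ 𝓝 x, z.1 ≠ 0 :=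
      tendsto_fst.eventually self_mem_nhdsWithin
    filter_upwards [this] with z hz
    by_cases h : z.2 = 0
    · simp [h]
    · rw [dslope_of_ne _ (mul_ne_zero hz h), slope_def_field]
      simp
      field_simp
  rcases n with _ | n
  · exact h0
  rw [CC_succ]
  refine ⟨h0, ?_⟩
  have hc := (Conv_of_smooth (P := ℝ) (E := ℝ) (p₀ := 0) (U := univ)
    (Φ := fun z => Real.exp (z.1 * z.2) • (1 : ℝ →L[ℝ] ℝ)) isOpen_univ (mem_univ _)
    (ContDiff.contDiffOn (by fun_prop))).mono (nhdsWithin_le_nhds (s := {0}ᶜ))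
  have e : fderiv ℝ (fun s : ℝ => s) = fun x : ℝ => Real.exp (0 * x) • (1 : ℝ →L[ℝ] ℝ) := by
    funext x; simp; rfl
  rw [e]
  refine (hc.cc n).congr ?_
  filter_upwards [self_mem_nhdsWithin] with t ht
  have ht : t ≠ 0 := ht
  funext s
  have h1 : HasDerivAt (fun s : ℝ => (Real.exp (t * s) - 1) / t) (Real.exp (t * s)) s := by
    have := ((((hasDerivAt_id s).const_mul t).exp).sub_const 1).div_const t
    simpa [ht] using this
  rw [h1.hasFDerivAt.fderiv]
  ext; simp

lemma CC.reindex {ι κ E G : Type} [NormedAddCommGroup E] [NormedSpace ℝ E]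
    [NormedAddCommGroup G] [NormedSpace ℝ G] {l : Filter ι} {l' : Filter κ} {n : ℕ}
    {F : ι → E → G} {f : E → G} (h : CC l n F f) {φ : κ → ι} (hφ : Tendsto φ l' l) :
    CC l' n (fun k => F (φ k)) f := by
  intro j hj x
  exact (h j hj x).comp (hφ.prodMap tendsto_id)

lemma conv_exp_series :
    Conv atTop (fun (n : ℕ) (s : ℝ) => ∑ k ∈ Finset.range n, s ^ k / (k.factorial : ℝ)) Real.exp := by
  refine ⟨Eventually.of_forall fun t => by fun_prop, Real.contDiff_exp, fun n => ?_⟩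
  have h0 : CC atTop 0 (fun (n : ℕ) (s : ℝ) => ∑ k ∈ Finset.range n, s ^ k / (k.factorial : ℝ))
      Real.exp := by
    rw [CC_zero]
    intro x
    have h1 : Tendsto (fun z : ℕ × ℝ => Real.exp z.2) (atTop ×ˢ 𝓝 x) (𝓝 (Real.exp x)) :=
      (Real.continuous_exp.tendsto x).comp tendsto_snd
    have h2 : Tendsto (fun z : ℕ × ℝ => (∑ k ∈ Finset.range z.1, z.2 ^ k / (k.factorial : ℝ))
        - Real.exp z.2) (atTop ×ˢ 𝓝 x) (𝓝 0) := by
      have h3 : Tendsto (fun z : ℕ × ℝ => (|x| + 1) ^ z.1 / (z.1.factorial : ℝ) * 2)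
          (atTop ×ˢ 𝓝 x) (𝓝 (0 * 2)) :=
        ((FloorSemiring.tendsto_pow_div_factorial_atTop (|x| + 1)).comp tendsto_fst).mul_const 2
      rw [zero_mul] at h3
      refine squeeze_zero_norm' ?_ h3
      have a1 : ∀ᶠ z : ℕ × ℝ in atTop ×ˢ 𝓝 x, |z.2| < |x| + 1 :=
        tendsto_snd.eventually ((continuous_abs.tendsto x).eventually (gt_mem_nhds (by linarith)))
      obtain ⟨N, hN⟩ := exists_nat_gt (2 * (|x| + 1))
      have a2 : ∀ᶠ z : ℕ × ℝ in atTop ×ˢ 𝓝 x, N ≤ z.1 :=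
        tendsto_fst.eventually (eventually_ge_atTop N)
      filter_upwards [a1, a2] with z hz hz2
      have hz3 : (N:ℝ) ≤ z.1 := by exact_mod_cast hz2
      have b := Complex.exp_bound' (x := (z.2 : ℂ)) (n := z.1) (by
        rw [Complex.norm_real, Real.norm_eq_abs, div_le_iff₀ (by positivity)]
        push_cast
        linarith)
      rw [norm_sub_rev]
      have e : Complex.exp (z.2:ℂ) - ∑ m ∈ Finset.range z.1, (z.2:ℂ) ^ m / (m.factorial : ℂ)
          = ((Real.exp z.2 - ∑ k ∈ Finset.range z.1, z.2 ^ k / (k.factorial : ℝ) : ℝ) : ℂ) := by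
        push_cast; rfl
      rw [e, Complex.norm_real, Complex.norm_real] at b
      refine b.trans ?_
      rw [Real.norm_eq_abs]
      gcongr
    simpa using h2.add h1
  induction n with
  | zero => exact h0
  | succ n ih =>
    rw [CC_succ]
    refine ⟨h0, ?_⟩
    have h1 := ih.reindex (tendsto_sub_atTop_nat 1)
    have h2 := h1.clm (Eventually.of_forall fun t => by fun_prop) Real.contDiff_exp
      ((ContinuousLinearMap.id ℝ ℝ).smulRight (1 : ℝ →L[ℝ] ℝ))
    have e : fderiv ℝ Real.exp = fun x : ℝ =>
        ((ContinuousLinearMap.id ℝ ℝ).smulRight (1 : ℝ →L[ℝ] ℝ)) (Real.exp x) := by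
      funext x
      rw [(Real.hasDerivAt_exp x).hasFDerivAt.fderiv]
      ext; simp
    rw [e]
    refine h2.congr ?_
    filter_upwards [eventually_ge_atTop 1] with m hm
    obtain ⟨m, rfl⟩ : ∃ k, m = k + 1 := ⟨m - 1, by omega⟩
    funext s
    have h1 : HasDerivAt (fun s : ℝ => ∑ k ∈ Finset.range (m + 1), s ^ k / (k.factorial : ℝ))
        (∑ k ∈ Finset.range m, s ^ k / (k.factorial : ℝ)) s := by
      have := HasDerivAt.fun_sum (u := Finset.range (m + 1)) fun k _ =>
        (hasDerivAt_pow k s).div_const (k.factorial : ℝ)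
      refine this.congr_deriv ?_
      rw [Finset.sum_range_succ']
      simp only [Nat.cast_zero, zero_mul, zero_div, add_zero]
      refine Finset.sum_congr rfl fun k _ => ?_
      rw [Nat.factorial_succ]
      push_cast
      have : (k.factorial : ℝ) ≠ 0 := by positivity
      have : (k:ℝ) + 1 ≠ 0 := by positivity
      field_simp
    rw [h1.hasFDerivAt.fderiv]
    ext; simp

/-- auxiliary class -/
def W2 (V0 : (Fin d → ℝ) → ℝ) (h : (Fin d → ℝ) → ℝ) : Prop :=
  ContDiff ℝ ∞ h ∧ ∀ a : Fin d → ℝ, VS V0 (fun q => Real.exp (∑ i, a i * q i) * (h q * gau q))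

variable {V0 : (Fin d → ℝ) → ℝ}

lemma Conv.mulc {ι E : Type} [NormedAddCommGroup E] [NormedSpace ℝ E] {l : Filter ι}
    {F : ι → E → ℝ} {f : E → ℝ} (h : Conv l F f) {g : E → ℝ} (hg : ContDiff ℝ ∞ g) :
    Conv l (fun i q => F i q * g q) (fun q => f q * g q) :=
  (Conv_const (f := fun y : ℝ × ℝ => y.1 * y.2) (by fun_prop)).comp (h.prod (Conv_const hg))

lemma W2_one (hV : ContDiff ℝ ∞ V0) {L : ℝ≥0} (hL : LipschitzWith L (fderiv ℝ V0)) :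
    W2 V0 (fun _ => 1) := by
  refine ⟨contDiff_const, fun a => ?_⟩
  have := ((VS_gau hV hL).translate hV hL a).smul (Real.exp ((∑ i, (a i)^2) / 2))
  convert this using 2 with q
  simp only [gau, one_mul, ← Real.exp_add]
  congr 1
  have : ∑ i, (q - a) i ^ 2 = ∑ i, (q i)^2 - 2 * ∑ i, a i * q i + ∑ i, (a i)^2 := by
    rw [Finset.mul_sum, ← Finset.sum_sub_distrib, ← Finset.sum_add_distrib]
    refine Finset.sum_congr rfl fun i _ => ?_
    simp only [Pi.sub_apply]; ring
  rw [this]; ring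

lemma W2.add {f g : (Fin d → ℝ) → ℝ} (hf : W2 V0 f) (hg : W2 V0 g) :
    W2 V0 (fun q => f q + g q) := by
  refine ⟨hf.1.add hg.1, fun a => ?_⟩
  convert (hf.2 a).add (hg.2 a) using 2 with q
  ring

lemma W2.smul {f : (Fin d → ℝ) → ℝ} (hf : W2 V0 f) (c : ℝ) :
    W2 V0 (fun q => c * f q) := by
  refine ⟨contDiff_const.mul hf.1, fun a => ?_⟩
  convert (hf.2 a).smul c using 2 with q
  ring

lemma W2.sum {ι : Type} (s : Finset ι) {F : ι → (Fin d → ℝ) → ℝ} (h : ∀ i ∈ s, W2 V0 (F i)) :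
    W2 V0 (fun q => ∑ i ∈ s, F i q) := by
  refine ⟨ContDiff.sum fun i hi => (h i hi).1, fun a => ?_⟩
  convert VS.sum s fun i hi => (h i hi).2 a using 2 with q
  rw [Finset.sum_mul, Finset.mul_sum]

lemma expdot_smooth (a : Fin d → ℝ) :
    ContDiff ℝ ∞ (fun q : Fin d → ℝ => Real.exp (∑ i, a i * q i)) := by fun_prop

lemma W2.lim {ι : Type} {l : Filter ι} [l.NeBot] {F : ι → (Fin d → ℝ) → ℝ} {f : (Fin d → ℝ) → ℝ}
    (hc : Conv l F f) (h : ∀ᶠ i in l, W2 V0 (F i)) : W2 V0 f := by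
  refine ⟨hc.sf, fun a => ?_⟩
  have := hc.mulc ((expdot_smooth a).mul gau_smooth)
  have e : ∀ f : (Fin d → ℝ) → ℝ, (fun q => Real.exp (∑ i, a i * q i) * (f q * gau q))
      = fun q => f q * (Real.exp (∑ i, a i * q i) * gau q) := fun f => by funext q; ring
  rw [e]
  refine VS.lim this (h.mono fun i hi => ?_)
  have := hi.2 a
  rwa [e] at this

lemma W2.coord {f : (Fin d → ℝ) → ℝ} (hf : W2 V0 f) (j : Fin d) :
    W2 V0 (fun q => q j * f q) := by
  refine ⟨(by fun_prop : ContDiff ℝ ∞ (fun q : Fin d → ℝ => q j)).mul hf.1, fun a => ?_⟩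
  have h1 : Conv (𝓝[≠] (0:ℝ)) (fun t (q : Fin d → ℝ) => (Real.exp (t * q j) - 1) / t)
      (fun q => q j) :=
    conv_slope_exp.comp (Conv_const (f := fun q : Fin d → ℝ => q j) (by fun_prop))
  have h2 := h1.mulc ((expdot_smooth a).mul (hf.1.mul gau_smooth))
  have e : (fun q => Real.exp (∑ i, a i * q i) * (q j * f q * gau q))
      = fun q => q j * (Real.exp (∑ i, a i * q i) * (f q * gau q)) := by funext q; ring
  rw [e]
  refine VS.lim h2 (Eventually.of_forall fun t => ?_)
  have := ((hf.2 (a + Pi.single j t)).smul t⁻¹).add ((hf.2 a).smul (-t⁻¹))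
  convert this using 2 with q
  have : ∑ i, (a + Pi.single j t : Fin d → ℝ) i * q i = ∑ i, a i * q i + t * q j := by
    simp [add_mul, Finset.sum_add_distrib, Pi.single_apply]
  rw [this, Real.exp_add]
  ring

lemma VS_narrow (hV : ContDiff ℝ ∞ V0) {L : ℝ≥0} (hL : LipschitzWith L (fderiv ℝ V0)) (μ : ℝ) :
    VS V0 (fun q => Real.exp (μ * ∑ i, (q i)^2)) := by
  have h1 : ∀ k : ℕ, W2 V0 (fun q => (∑ i, (q i)^2) ^ k) := by
    intro k
    induction k with
    | zero => simpa using W2_one hV hL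
    | succ k ih =>
      have := W2.sum Finset.univ fun i _ => (ih.coord i).coord i
      convert this using 2 with q
      rw [pow_succ, Finset.mul_sum]
      refine Finset.sum_congr rfl fun i _ => by ring
  have h2 : W2 V0 (fun q => Real.exp ((μ + 1/2) * ∑ i, (q i)^2)) := by
    have hc := conv_exp_series.comp (Conv_const
      (f := fun q : Fin d → ℝ => (μ + 1/2) * ∑ i, (q i)^2) (by fun_prop))
    refine W2.lim hc (Eventually.of_forall fun n => W2.sum _ fun k _ => ?_)
    convert (h1 k).smul ((μ + 1/2)^k / k.factorial) using 2 with q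
    rw [mul_pow]; ring
  convert h2.2 0 using 2 with q
  simp only [gau, ← Real.exp_add]
  simp
  ring
end narrow

section convolution
open Set Filter Topology
open scoped ContDiff NNReal

variable {A : Type} [MeasurableSpace A] {ν : Measure A} {E G : Type}
  [NormedAddCommGroup E] [NormedSpace ℝ E] [NormedAddCommGroup G] [NormedSpace ℝ G]

/-- uniform local bounds on all derivatives of `M` along `q - r a` -/
def BDD {B : Type} (M : E → G) (r : B → E) : Prop :=
  ∀ (j : ℕ) (R : ℝ), ∃ C : ℝ, ∀ a q, ‖q‖ < R → ‖iteratedFDeriv ℝ j M (q - r a)‖ ≤ C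

lemma BDD.fderiv {B : Type} {M : E → G} {r : B → E} (h : BDD M r) : BDD (fderiv ℝ M) r := by
  intro j R
  obtain ⟨C, hC⟩ := h (j + 1) R
  refine ⟨C, fun a q hq => ?_⟩
  rw [norm_iteratedFDeriv_fderiv]
  exact hC a q hq

lemma BDD.zero {B : Type} {M : E → G} {r : B → E} (h : BDD M r) (R : ℝ) :
    ∃ C : ℝ, 0 ≤ C ∧ ∀ a q, ‖q‖ < R → ‖M (q - r a)‖ ≤ C := by
  obtain ⟨C, hC⟩ := h 0 R
  refine ⟨max C 0, le_max_right _ _, fun a q hq => ?_⟩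
  have := hC a q hq
  rw [norm_iteratedFDeriv_zero] at this
  exact this.trans (le_max_left _ _)

variable [CompleteSpace G]

lemma J_meas {M : E → G} (hM : ContDiff ℝ ∞ M) {w : A → ℝ} (hw : AEStronglyMeasurable w ν)
    {r : A → E} (hr : AEStronglyMeasurable r ν) (q : E) :
    AEStronglyMeasurable (fun a => w a • M (q - r a)) ν :=
  hw.smul (hM.continuous.comp_aestronglyMeasurable (aestronglyMeasurable_const.sub hr))

lemma J_hasFDerivAt {M : E → G} (hM : ContDiff ℝ ∞ M) {w W : A → ℝ}
    (hw : AEStronglyMeasurable w ν) (hW : Integrable W ν) (hwW : ∀ a, |w a| ≤ W a)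
    {r : A → E} (hr : AEStronglyMeasurable r ν) (hb : BDD M r) (q : E) :
    HasFDerivAt (fun q => ∫ a, w a • M (q - r a) ∂ν) (∫ a, w a • fderiv ℝ M (q - r a) ∂ν) q := by
  have hM' : ContDiff ℝ ∞ (fderiv ℝ M) := hM.fderiv_right (by exact_mod_cast le_top)
  obtain ⟨C, hC0, hC⟩ := hb.zero (‖q‖ + 1)
  obtain ⟨C', hC0', hC'⟩ := hb.fderiv.zero (‖q‖ + 1)
  have hball : ∀ x ∈ Metric.ball q 1, ‖x‖ < ‖q‖ + 1 := by
    intro x hx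
    have := norm_sub_norm_le x q
    rw [mem_ball_iff_norm] at hx
    linarith
  refine hasFDerivAt_integral_of_dominated_of_fderiv_le (Metric.ball_mem_nhds q one_pos)
    (F' := fun q a => w a • fderiv ℝ M (q - r a))
    (bound := fun a => W a * C') (Eventually.of_forall fun x => J_meas hM hw hr x) ?_
    (J_meas hM' hw hr q) ?_ (hW.mul_const _) ?_
  · refine (hW.mul_const C).mono' (J_meas hM hw hr q) (Eventually.of_forall fun a => ?_)
    rw [norm_smul]
    exact mul_le_mul (hwW a) (hC a q (by linarith)) (norm_nonneg _) ((abs_nonneg _).trans (hwW a))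
  · refine Eventually.of_forall fun a x hx => ?_
    rw [norm_smul]
    exact mul_le_mul (hwW a) (hC' a x (hball x hx)) (norm_nonneg _)
      ((abs_nonneg _).trans (hwW a))
  · refine Eventually.of_forall fun a x hx => ?_
    have h1 : HasFDerivAt M (fderiv ℝ M (x - r a)) (x - r a) :=
      (hM.differentiable (by simp) _).hasFDerivAt
    have h2 := h1.comp x ((hasFDerivAt_id x).sub_const (r a))
    exact h2.const_smul (w a)

lemma J_contDiff_nat (n : ℕ) : ∀ {G : Type} [NormedAddCommGroup G] [NormedSpace ℝ G]
    [CompleteSpace G] {M : E → G} (_ : ContDiff ℝ ∞ M) {w W : A → ℝ}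
    (_ : AEStronglyMeasurable w ν) (_ : Integrable W ν) (_ : ∀ a, |w a| ≤ W a)
    {r : A → E} (_ : AEStronglyMeasurable r ν) (_ : BDD M r),
    ContDiff ℝ n (fun q => ∫ a, w a • M (q - r a) ∂ν) := by
  induction n with
  | zero =>
    intro G _ _ _ M hM w W hw hW hwW r hr hb
    rw [Nat.cast_zero, contDiff_zero]
    exact continuous_iff_continuousAt.2 fun q => (J_hasFDerivAt hM hw hW hwW hr hb q).continuousAt
  | succ n ih =>
    intro G _ _ _ M hM w W hw hW hwW r hr hb
    push_cast
    rw [contDiff_succ_iff_hasFDerivAt]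
    exact ⟨_, ih (hM.fderiv_right (by exact_mod_cast le_top)) hw hW hwW hr hb.fderiv,
      J_hasFDerivAt hM hw hW hwW hr hb⟩

lemma int_cc {ι : Type} {l : Filter ι} [l.IsCountablyGenerated] (n : ℕ) :
    ∀ {G : Type} [NormedAddCommGroup G] [NormedSpace ℝ G]
    [CompleteSpace G] {M : E → G} (_ : ContDiff ℝ ∞ M) {w : ι → A → ℝ} {w0 W : A → ℝ}
    (_ : ∀ i, AEStronglyMeasurable (w i) ν) (_ : AEStronglyMeasurable w0 ν)
    (_ : Integrable W ν) (_ : ∀ i a, |w i a| ≤ W a) (_ : ∀ a, |w0 a| ≤ W a)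
    {r : ι → A → E} {r0 : A → E}
    (_ : ∀ i, AEStronglyMeasurable (r i) ν) (_ : AEStronglyMeasurable r0 ν)
    (_ : BDD M (fun z : ι × A => r z.1 z.2)) (_ : BDD M r0)
    (_ : ∀ᵐ a ∂ν, Tendsto (fun i => w i a) l (𝓝 (w0 a)))
    (_ : ∀ᵐ a ∂ν, Tendsto (fun i => r i a) l (𝓝 (r0 a))),
    CC l n (fun i q => ∫ a, w i a • M (q - r i a) ∂ν) (fun q => ∫ a, w0 a • M (q - r0 a) ∂ν) := by
  have key : ∀ {G : Type} [NormedAddCommGroup G] [NormedSpace ℝ G]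
    [CompleteSpace G] {M : E → G} (_ : ContDiff ℝ ∞ M) {w : ι → A → ℝ} {w0 W : A → ℝ}
    (_ : ∀ i, AEStronglyMeasurable (w i) ν) (_ : AEStronglyMeasurable w0 ν)
    (_ : Integrable W ν) (_ : ∀ i a, |w i a| ≤ W a) (_ : ∀ a, |w0 a| ≤ W a)
    {r : ι → A → E} {r0 : A → E}
    (_ : ∀ i, AEStronglyMeasurable (r i) ν) (_ : AEStronglyMeasurable r0 ν)
    (_ : BDD M (fun z : ι × A => r z.1 z.2)) (_ : BDD M r0)
    (_ : ∀ᵐ a ∂ν, Tendsto (fun i => w i a) l (𝓝 (w0 a)))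
    (_ : ∀ᵐ a ∂ν, Tendsto (fun i => r i a) l (𝓝 (r0 a))),
    CC l 0 (fun i q => ∫ a, w i a • M (q - r i a) ∂ν)
      (fun q => ∫ a, w0 a • M (q - r0 a) ∂ν) := by
    intro G _ _ _ M hM w w0 W hw hw0 hW hwW hw0W r r0 hr hr0 hb hb0 hwt hrt
    rw [CC_zero]
    intro x
    obtain ⟨C, hC0, hC⟩ := hb.zero (‖x‖ + 1)
    refine tendsto_integral_filter_of_dominated_convergence (fun a => W a * C)
      (Eventually.of_forall fun z => J_meas hM (hw z.1) (hr z.1) z.2) ?_ (hW.mul_const C) ?_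
    · have : ∀ᶠ z : ι × E in l ×ˢ 𝓝 x, ‖z.2‖ < ‖x‖ + 1 :=
        tendsto_snd.eventually ((continuous_norm.tendsto x).eventually (gt_mem_nhds (by linarith)))
      filter_upwards [this] with z hz
      refine Eventually.of_forall fun a => ?_
      rw [norm_smul]
      exact mul_le_mul (hwW _ a) (hC (z.1, a) z.2 hz) (norm_nonneg _)
        ((abs_nonneg _).trans (hw0W a))
    · filter_upwards [hwt, hrt] with a h1 h2
      exact (h1.comp tendsto_fst).smul ((hM.continuous.tendsto _).comp
        (tendsto_snd.sub (h2.comp tendsto_fst)))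
  induction n with
  | zero => exact key
  | succ n ih =>
    intro G _ _ _ M hM w w0 W hw hw0 hW hwW hw0W r r0 hr hr0 hb hb0 hwt hrt
    rw [CC_succ]
    refine ⟨key hM hw hw0 hW hwW hw0W hr hr0 hb hb0 hwt hrt, ?_⟩
    have hbi : ∀ i, BDD M (r i) := fun i j R => by
      obtain ⟨C, hC⟩ := hb j R
      exact ⟨C, fun a q hq => hC (i, a) q hq⟩
    have e0 := funext fun q => (J_hasFDerivAt hM hw0 hW hw0W hr0 hb0 q).fderiv
    have e := fun i => funext fun q => (J_hasFDerivAt hM (hw i) hW (hwW i) (hr i) (hbi i) q).fderiv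
    rw [e0]
    simp_rw [e]
    exact ih (hM.fderiv_right (by exact_mod_cast le_top)) hw hw0 hW hwW hw0W hr hr0 hb.fderiv
      hb0.fderiv hwt hrt

lemma int_conv {ι : Type} {l : Filter ι} [l.IsCountablyGenerated]
    {M : E → G} (hM : ContDiff ℝ ∞ M) {w : ι → A → ℝ} {w0 W : A → ℝ}
    (hw : ∀ i, AEStronglyMeasurable (w i) ν) (hw0 : AEStronglyMeasurable w0 ν)
    (hW : Integrable W ν) (hwW : ∀ i a, |w i a| ≤ W a) (hw0W : ∀ a, |w0 a| ≤ W a)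
    {r : ι → A → E} {r0 : A → E}
    (hr : ∀ i, AEStronglyMeasurable (r i) ν) (hr0 : AEStronglyMeasurable r0 ν)
    (hb : BDD M (fun z : ι × A => r z.1 z.2)) (hb0 : BDD M r0)
    (hwt : ∀ᵐ a ∂ν, Tendsto (fun i => w i a) l (𝓝 (w0 a)))
    (hrt : ∀ᵐ a ∂ν, Tendsto (fun i => r i a) l (𝓝 (r0 a))) :
    Conv l (fun i q => ∫ a, w i a • M (q - r i a) ∂ν) (fun q => ∫ a, w0 a • M (q - r0 a) ∂ν) := by
  have hbi : ∀ i, BDD M (r i) := fun i j R => by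
    obtain ⟨C, hC⟩ := hb j R
    exact ⟨C, fun a q hq => hC (i, a) q hq⟩
  exact ⟨Eventually.of_forall fun i => contDiff_infty.2 fun n =>
      J_contDiff_nat n hM (hw i) hW (hwW i) (hr i) (hbi i),
    contDiff_infty.2 fun n => J_contDiff_nat n hM hw0 hW hw0W hr0 hb0,
    fun n => int_cc n hM hw hw0 hW hwW hw0W hr hr0 hb hb0 hwt hrt⟩

end convolution

section density
open Set Filter Topology
open scoped ContDiff NNReal
variable {d : ℕ} {V0 : (Fin d → ℝ) → ℝ}

lemma integral_simple {A E : Type} [MeasurableSpace A] {ν : Measure A} [IsFiniteMeasure ν]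
    (s : SimpleFunc A E) (g : E → ℝ) :
    ∫ a, g (s a) ∂ν = ∑ b ∈ s.range, ν.real (s ⁻¹' {b}) * g b := by
  have e : ∀ a, g (s a) = ∑ b ∈ s.range, (s ⁻¹' {b}).indicator (fun _ => g b) a := by
    intro a
    rw [Finset.sum_eq_single (s a)]
    · simp
    · intro b _ hb
      rw [indicator_of_notMem]
      simpa using hb.symm
    · intro h
      exact absurd (s.mem_range_self a) h
  simp_rw [e]
  rw [integral_finsetSum _ fun b _ => (integrable_const (g b)).indicator (s.measurableSet_fiber b)]
  refine Finset.sum_congr rfl fun b _ => ?_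
  rw [integral_indicator_const _ (s.measurableSet_fiber b)]
  rfl

lemma BDD_of_bounded {B E G : Type} [NormedAddCommGroup E] [NormedSpace ℝ E] [ProperSpace E]
    [NormedAddCommGroup G] [NormedSpace ℝ G] {M : E → G} (hM : ContDiff ℝ ∞ M) {r : B → E} {R : ℝ}
    (hr : ∀ a, ‖r a‖ ≤ R) : BDD M r := by
  intro j R'
  obtain ⟨C, hC⟩ := (isCompact_closedBall (0 : E) (R' + R)).exists_bound_of_continuousOn
    (hM.continuous_iteratedFDeriv (m := j) (by exact_mod_cast le_top)).continuousOn
  refine ⟨C, fun a q hq => hC _ ?_⟩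
  rw [mem_closedBall_zero_iff]
  have := norm_sub_le q (r a)
  have := hr a
  linarith

lemma BDD_of_compact {B E G : Type} [NormedAddCommGroup E] [NormedSpace ℝ E]
    [NormedAddCommGroup G] [NormedSpace ℝ G] {M : E → G} (hM : ContDiff ℝ ∞ M)
    (hc : HasCompactSupport M) (r : B → E) : BDD M r := by
  intro j R'
  obtain ⟨C, hC⟩ := (hc.iteratedFDeriv (𝕜 := ℝ) j).exists_bound_of_continuous
    (hM.continuous_iteratedFDeriv (m := j) (by exact_mod_cast le_top))
  exact ⟨C, fun a q hq => hC _⟩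

lemma VS_conv (hV : ContDiff ℝ ∞ V0) {L : ℝ≥0} (hL : LipschitzWith L (fderiv ℝ V0))
    {N f : (Fin d → ℝ) → ℝ} (hN : VS V0 N) (hf : Continuous f) (hc : HasCompactSupport f) :
    VS V0 (fun q => ∫ a, f a * N (q - a)) := by
  obtain ⟨R, hR0, hR⟩ : ∃ R : ℝ, 0 ≤ R ∧ tsupport f ⊆ Metric.closedBall 0 R := by
    obtain ⟨R, hR⟩ := hc.isCompact.isBounded.subset_closedBall 0
    exact ⟨max R 0, le_max_right _ _, hR.trans (Metric.closedBall_subset_closedBall (le_max_left _ _))⟩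
  obtain ⟨C, hC⟩ := hc.exists_bound_of_continuous hf
  set S := Metric.closedBall (0 : Fin d → ℝ) R with hS
  have hSm : MeasurableSet S := measurableSet_closedBall
  have h0 : (0 : Fin d → ℝ) ∈ S := by simp [hS, hR0]
  set ν : Measure (Fin d → ℝ) := volume.restrict S with hν
  have : IsFiniteMeasure ν := ⟨by
    rw [hν, Measure.restrict_apply_univ]; exact measure_closedBall_lt_top⟩
  let r : ℕ → SimpleFunc (Fin d → ℝ) (Fin d → ℝ) := SimpleFunc.approxOn id measurable_id S 0 h0
  have hr : ∀ n a, ‖r n a‖ ≤ R := fun n a => by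
    have := SimpleFunc.approxOn_mem measurable_id h0 n a
    simpa [hS] using this
  have hr0 : ∀ a, ‖S.indicator id a‖ ≤ R := fun a => by
    by_cases h : a ∈ S
    · rw [indicator_of_mem h]; simpa [hS] using h
    · rw [indicator_of_notMem h]; simpa using hR0
  have hrt : ∀ᵐ a ∂ν, Tendsto (fun n => r n a) atTop (𝓝 (S.indicator id a)) := by
    filter_upwards [ae_restrict_mem hSm] with a ha
    rw [indicator_of_mem ha]
    exact SimpleFunc.tendsto_approxOn measurable_id h0 (subset_closure ha)
  have key := int_conv (ν := ν) (l := atTop) hN.1 (w := fun n a => f (r n a)) (w0 := fun a => f (S.indicator id a))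
    (W := fun _ => C) (r := fun n a => r n a) (r0 := S.indicator id)
    (fun n => hf.comp_aestronglyMeasurable (r n).aestronglyMeasurable)
    (hf.comp_aestronglyMeasurable (measurable_id.indicator hSm).aestronglyMeasurable)
    (integrable_const C) (fun n a => hC _) (fun a => hC _)
    (fun n => (r n).aestronglyMeasurable) (measurable_id.indicator hSm).aestronglyMeasurable
    (BDD_of_bounded hN.1 fun z => hr z.1 z.2) (BDD_of_bounded hN.1 hr0)
    (hrt.mono fun a ha => (hf.tendsto _).comp ha) hrt
  have e : (fun q => ∫ a, f a * N (q - a))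
      = fun q => ∫ a, f (S.indicator id a) • N (q - S.indicator id a) ∂ν := by
    funext q
    rw [← setIntegral_eq_integral_of_forall_compl_eq_zero (s := S)]
    · refine setIntegral_congr_fun hSm fun a ha => ?_
      simp only [indicator_of_mem ha, id, smul_eq_mul]
    · intro a ha
      rw [image_eq_zero_of_notMem_tsupport fun h => ha (hR h), zero_mul]
  rw [e]
  refine VS.lim key (Eventually.of_forall fun n => ?_)
  have e2 : ∀ q, ∫ a, f (r n a) • N (q - r n a) ∂ν
      = ∑ b ∈ (r n).range, ν.real (r n ⁻¹' {b}) * (f b * N (q - b)) := fun q =>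
    integral_simple (r n) (fun b => f b * N (q - b))
  simp_rw [e2]
  exact VS.sum _ fun b _ => ((hN.translate hV hL b).smul (f b)).smul _

lemma gau_integrable : Integrable (gau (d := d)) := by
  have h1 : Integrable (fun x : ℝ => Real.exp (-(1/2) * x ^ 2)) :=
    integrable_exp_neg_mul_sq (by norm_num)
  have := Integrable.fintype_prod (ι := Fin d) (μ := fun _ => (volume : Measure ℝ))
    (f := fun _ => fun x : ℝ => Real.exp (-(1/2) * x ^ 2)) fun _ => h1
  refine this.congr (Eventually.of_forall fun q => ?_)
  simp only [gau, ← Real.exp_sum, ← Finset.mul_sum]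
  congr 1
  ring

lemma VS_compact (hV : ContDiff ℝ ∞ V0) {L : ℝ≥0} (hL : LipschitzWith L (fderiv ℝ V0))
    {f : (Fin d → ℝ) → ℝ} (hf : ContDiff ℝ ∞ f) (hc : HasCompactSupport f) : VS V0 f := by
  have hg0 : ∀ q : Fin d → ℝ, |gau q| ≤ gau q := fun q => (abs_of_pos (Real.exp_pos _)).le
  have hgm := (gau_smooth (d := d)).continuous.aestronglyMeasurable (μ := volume)
  have key := int_conv (ν := volume) (l := 𝓝[≠] (0:ℝ)) hf (w := fun _ a => gau a) (w0 := gau)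
    (W := gau) (r := fun t a => t • a) (r0 := fun _ => 0) (fun _ => hgm) hgm gau_integrable
    (fun _ => hg0) hg0 (fun t => (continuous_const_smul t).aestronglyMeasurable)
    aestronglyMeasurable_const (BDD_of_compact hf hc _) (BDD_of_compact hf hc _)
    (Eventually.of_forall fun a => tendsto_const_nhds)
    (Eventually.of_forall fun a => by
      have : Tendsto (fun t : ℝ => t • a) (𝓝 0) (𝓝 ((0:ℝ) • a)) :=
        (continuous_id.smul continuous_const).tendsto 0
      rw [zero_smul] at this
      exact this.mono_left nhdsWithin_le_nhds)
  have hZ : 0 < ∫ q : Fin d → ℝ, gau q := integral_exp_pos gau_integrable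
  have hlim : VS V0 (fun q => ∫ a : Fin d → ℝ, gau a • f (q - 0)) := by
    refine VS.lim key ?_
    filter_upwards [self_mem_nhdsWithin] with t ht
    have ht : t ≠ 0 := ht
    have h1 := (VS_conv hV hL (VS_narrow hV hL (-(1/(2*t^2)))) hf.continuous hc).smul
      |(t ^ Module.finrank ℝ (Fin d → ℝ))⁻¹|
    convert h1 using 2 with q
    rw [← integral_sub_left_eq_self (fun a => f a * rexp (-(1 / (2 * t ^ 2)) * ∑ i, (q - a) i ^ 2))
      volume q, ← smul_eq_mul, ← Measure.integral_comp_smul]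
    refine integral_congr_ae (Eventually.of_forall fun a => ?_)
    simp only [smul_eq_mul, gau]
    rw [mul_comm]
    congr 2
    simp only [sub_sub_cancel, Pi.smul_apply, smul_eq_mul, mul_pow, ← Finset.mul_sum]
    field_simp
  have := hlim.smul (∫ q : Fin d → ℝ, gau q)⁻¹
  convert this using 2 with q
  simp only [sub_zero, smul_eq_mul]
  rw [integral_mul_const]
  field_simp

lemma VS_all (hV : ContDiff ℝ ∞ V0) {L : ℝ≥0} (hL : LipschitzWith L (fderiv ℝ V0))
    {f : (Fin d → ℝ) → ℝ} (hf : ContDiff ℝ ∞ f) : VS V0 f := by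
  let χ : ∀ n : ℕ, ContDiffBump (0 : Fin d → ℝ) := fun n =>
    ⟨(n:ℝ) + 1, (n:ℝ) + 2, by positivity, by linarith⟩
  have hs : ∀ n, ContDiff ℝ ∞ (fun q => χ n q * f q) := fun n => (χ n).contDiff.mul hf
  have hc : Conv atTop (fun n q => χ n q * f q) f := by
    refine ⟨Eventually.of_forall hs, hf, fun m j hj x => ?_⟩
    refine (CC_const hf (l := (atTop : Filter ℕ)) (n := m) j hj x).congr' ?_
    have h1 : ∀ᶠ z : ℕ × (Fin d → ℝ) in atTop ×ˢ 𝓝 x, ‖z.2‖ < ‖x‖ + 1 :=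
      tendsto_snd.eventually ((continuous_norm.tendsto x).eventually (gt_mem_nhds (by linarith)))
    have h2 : ∀ᶠ z : ℕ × (Fin d → ℝ) in atTop ×ˢ 𝓝 x, ‖x‖ ≤ z.1 :=
      tendsto_fst.eventually ((tendsto_natCast_atTop_atTop (R := ℝ)).eventually_ge_atTop _)
    filter_upwards [h1, h2] with z hz1 hz2
    have : (fun q => χ z.1 q * f q) =ᶠ[𝓝 z.2] f := by
      filter_upwards [Metric.isOpen_ball.mem_nhds (show z.2 ∈ Metric.ball 0 ((z.1:ℝ) + 1) by
        rw [mem_ball_zero_iff]; linarith)] with q hq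
      rw [(χ z.1).one_of_mem_closedBall (Metric.ball_subset_closedBall hq), one_mul]
    exact (this.iteratedFDeriv ℝ j).eq_of_nhds.symm
  exact VS.lim hc (Eventually.of_forall fun n =>
    VS_compact hV hL (hs n) ((χ n).hasCompactSupport.mul_right))
end density

section final
open Set Filter Topology
open scoped ContDiff NNReal
variable {d : ℕ} {V0 : (Fin d → ℝ) → ℝ}

lemma quad_shear (hV : ContDiff ℝ ∞ V0) {L : ℝ≥0} (hL : LipschitzWith L (fderiv ℝ V0)) (c : ℝ) :
    ARch (eucHam V0) 0 (fun x : Phase d => (x.1, x.2 - c • x.1)) := by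
  have hs : ContDiff ℝ ∞ (fun q : Fin d → ℝ => ∑ i, (q i)^2 / 2) := by fun_prop
  have h := (VS_all hV hL hs).2 c
  convert h using 2 with x
  rw [vshear_eq]
  have : gr (fun q : Fin d → ℝ => c * ∑ i, (q i)^2 / 2) x.1 = c • x.1 := by
    have h2 := (HasFDerivAt.fun_sum (u := Finset.univ) fun j _ =>
      (((ContinuousLinearMap.proj j : (Fin d → ℝ) →L[ℝ] ℝ).hasFDerivAt (x := x.1)).pow 2).mul_const
        (1/2:ℝ)).const_mul c
    have e : (fun q : Fin d → ℝ => c * ∑ i, (q i)^2 / 2)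
      = fun q => c * ∑ i, (ContinuousLinearMap.proj (R := ℝ) (φ := fun _ : Fin d => ℝ) i q) ^ 2
          * (1/2:ℝ) := by
      funext q; simp [div_eq_mul_inv]
    funext i
    rw [gr_apply, e, h2.fderiv]
    simp [Pi.single_apply]
  exact Prod.ext rfl (congrArg (x.2 - ·) this.symm)

lemma main_thm (hV : ContDiff ℝ ∞ V0) {L : ℝ≥0} (hL : LipschitzWith L (fderiv ℝ V0))
    {g : (Fin d → ℝ) → ℝ} (hg : ContDiff ℝ ∞ g) : ARch (eucHam V0) 0 (hshear g) := by
  obtain ⟨U, hU, h0, Y, hY, hY2⟩ := quad_flow (gr V0) (gr_smooth hV) L (gr_lip hL)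
  let Jh : ℝ × Phase d → Phase d := fun z =>
    (z.2.2 + (2 * z.1) • (Y (z.1, (z.2.1, z.1 • z.2.2))).1,
      - z.2.1 + z.1 ^ 2 • ((Y (z.1, (z.2.1, z.1 • z.2.2))).2 - (2:ℝ) • (Y (z.1, (z.2.1, z.1 • z.2.2))).1))
  let Kh : ℝ × Phase d → Phase d := fun z =>
    (z.2.2 + (2 * z.1 ^ 2) • (Y (z.1, (z.1 • z.2.1, z.2.2))).1,
      - z.2.1 + z.1 • ((Y (z.1, (z.1 • z.2.1, z.2.2))).2 - (2:ℝ) • (Y (z.1, (z.1 • z.2.1, z.2.2))).1))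
  have sJ : ContDiffOn ℝ ∞ Jh (U ×ˢ univ) := by
    have : ContDiffOn ℝ ∞ (fun z : ℝ × Phase d => Y (z.1, (z.2.1, z.1 • z.2.2))) (U ×ˢ univ) :=
      hY.comp (ContDiff.contDiffOn (by fun_prop)) fun z hz => ⟨hz.1, mem_univ _⟩
    exact (show ContDiff ℝ ∞ (fun w : (ℝ × Phase d) × Phase d =>
      ((w.1.2.2 + (2 * w.1.1) • w.2.1, - w.1.2.1 + w.1.1 ^ 2 • (w.2.2 - (2:ℝ) • w.2.1)) : Phase d))
      by fun_prop).comp_contDiffOn (contDiffOn_id.prodMk this)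
  have sK : ContDiffOn ℝ ∞ Kh (U ×ˢ univ) := by
    have : ContDiffOn ℝ ∞ (fun z : ℝ × Phase d => Y (z.1, (z.1 • z.2.1, z.2.2))) (U ×ˢ univ) :=
      hY.comp (ContDiff.contDiffOn (by fun_prop)) fun z hz => ⟨hz.1, mem_univ _⟩
    exact (show ContDiff ℝ ∞ (fun w : (ℝ × Phase d) × Phase d =>
      ((w.1.2.2 + (2 * w.1.1 ^ 2) • w.2.1, - w.1.2.1 + w.1.1 • (w.2.2 - (2:ℝ) • w.2.1)) : Phase d))
      by fun_prop).comp_contDiffOn (contDiffOn_id.prodMk this)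
  have cJ := (Conv_of_smooth hU h0 sJ).mono (nhdsWithin_le_nhds (s := Ioi (0:ℝ)))
  have cK := (Conv_of_smooth hU h0 sK).mono (nhdsWithin_le_nhds (s := Ioi (0:ℝ)))
  have cV := Conv_const (l := 𝓝[>] (0:ℝ)) (vshear_smooth hg)
  have cc := cK.comp (cJ.comp (cK.comp (cV.comp cJ)))
  have e0 : (fun x => Kh (0, Jh (0, Kh (0, vshear g (Jh (0, x)))))) = hshear g := by
    funext x
    simp only [Kh, Jh, vshear_eq]
    refine Prod.ext ?_ ?_
    · simp [hshear]
      funext i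
      simp [gr_apply, add_comm]
    · simp [hshear]
  rw [e0] at cc
  have hT : Tendsto (fun δ : ℝ => 4 * δ) (𝓝[>] 0) (𝓝 0) := by
    have : Tendsto (fun δ : ℝ => 4 * δ) (𝓝 0) (𝓝 (4 * 0)) :=
      Continuous.tendsto (by fun_prop) _
    rw [mul_zero] at this
    exact this.mono_left nhdsWithin_le_nhds
  refine ARch.lim (T := fun δ : ℝ => 4 * δ) ?_ hT cc
  filter_upwards [cJ.sF, self_mem_nhdsWithin, nhdsWithin_le_nhds (hU.mem_nhds h0)] with δ s hδ hδU
  have hδ' : (0:ℝ) < δ := hδ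
  have hne := hδ'.ne'
  obtain ⟨φ, hφ⟩ := exists_ham_flow hV hL 0
  have hz : ∀ q, gr (pot (0 : (Fin d → ℝ) × ℝ)) q = 0 := fun q => by rw [pot_gr]; simp
  let V : Phase d → Phase d := fun x => (x.1, x.2 - δ⁻¹ • x.1)
  let V' : Phase d → Phase d := fun x => (x.1, x.2 - (-δ⁻¹) • x.1)
  let D : Phase d → Phase d := fun x => (δ • x.1, δ⁻¹ • x.2)
  have key : ∀ x, V (φ δ (V x)) = D (Jh (δ, x)) := by
    intro x
    have h1 := hY2 δ hδU (x.1, δ • x.2) (fun s =>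
      ((1 / (2 * δ^2)) • ((φ (δ * s) (V x)).1 - ((1 - s) • x.1 + s • (δ • x.2))),
        δ⁻¹ • ((φ (δ * s) (V x)).2 - (x.2 - δ⁻¹ • x.1))))
      (by simp [hφ.1, V]) (fun s => by
        have hf := flow_rescale hV hφ δ (V x) s
        rw [HasDerivAt.phase] at hf ⊢
        have hb : HasDerivAt (fun s : ℝ => (1 - s) • x.1 + s • (δ • x.2)) (δ • x.2 - x.1) s := by
          have := (((hasDerivAt_id s).const_sub 1).smul_const x.1).add
            ((hasDerivAt_id s).smul_const (δ • x.2))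
          refine this.congr_deriv ?_
          simp; abel
        refine ⟨((hf.1.sub hb).const_smul (1 / (2 * δ^2))).congr_deriv ?_,
          ((hf.2.sub_const (x.2 - δ⁻¹ • x.1)).const_smul δ⁻¹).congr_deriv ?_⟩
        · funext i
          simp
          field_simp
        · simp only [hz, sub_zero, smul_smul, inv_mul_cancel₀ hne, one_smul]
          congr 2
          funext i
          simp
          field_simp
          ring)
    simp only [mul_one, sub_self, zero_smul, one_smul, zero_add] at h1
    simp only [D, Jh, V]
    rw [h1]
    refine Prod.ext ?_ ?_
    · funext i
      simp [V]
      field_simp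
      ring
    · funext i
      simp [V]
      field_simp
      ring
  have hVV : ∀ x, V' (V x) = x := fun x => by simp [V, V']
  have hVV' : ∀ x, V (V' x) = x := fun x => by simp [V, V']
  have sV' : ContDiff ℝ ∞ V' := by simp only [V']; fun_prop
  have sD : ContDiff ℝ ∞ D := by simp only [D]; fun_prop
  have hs : ContDiff ℝ ∞ (φ δ) := by
    have : φ δ = fun x => V' (D (Jh (δ, V' x))) := by
      funext x
      rw [← key, hVV', hVV]
    rw [this]
    exact sV'.comp (sD.comp (s.comp sV'))
  have rφ : ARch (eucHam V0) δ (φ δ) := ARch_exact hδ'.le le_rfl hs (Reachable_flow hδ'.le _ hφ)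
  have rV : ARch (eucHam V0) 0 V := quad_shear hV hL δ⁻¹
  have rJ : ARch (eucHam V0) δ (fun x => D (Jh (δ, x))) := by
    have := rV.comp (rφ.comp rV)
    simp only [zero_add, add_zero, key] at this
    exact this
  have hg' : ContDiff ℝ ∞ (fun q => g (δ⁻¹ • q)) := hg.comp (by fun_prop)
  have rg : ARch (eucHam V0) 0 (vshear (fun q => g (δ⁻¹ • q))) := by
    simpa using (VS_all hV hL hg').2 1
  have hgD : ∀ x, vshear (fun q => g (δ⁻¹ • q)) (D x) = D (vshear g x) := by
    intro x
    have : ∀ q, gr (fun q => g (δ⁻¹ • q)) q = δ⁻¹ • gr g (δ⁻¹ • q) := by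
      intro q
      rw [gr, gr, fderiv_comp_smul, map_smul]
    simp [vshear_eq, D, this, smul_smul, hne, smul_sub]
  have hKD : ∀ x, D (Jh (δ, D x)) = Kh (δ, x) := by
    intro x
    simp only [D, Jh, Kh, smul_smul, mul_inv_cancel₀ hne, one_smul]
    refine Prod.ext ?_ ?_
    · funext i
      simp only [Pi.smul_apply, Pi.add_apply, smul_eq_mul]
      field_simp
    · funext i
      simp
      field_simp
  have := rJ.comp (rJ.comp (rJ.comp (rg.comp rJ)))
  simp only [hgD, hKD] at this
  rwa [show δ + 0 + δ + δ + δ = 4 * δ by ring] at this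
end final

/-- **Theorem (horizontal shears on `T*ℝ^d` are small-time approximately reachable).**
For the Euclidean control system `H_u(q,p) = |p|²/2 + V_0(q) + Σ_{j=1}^d u_j q_j +
u_{d+1} e^{−|q|²/2}` with `V_0` smooth with globally Lipschitz gradient, every horizontal
shear `(q,p) ↦ (q + ∇g(p), p)`, `g ∈ C^∞(ℝ^d,ℝ)`, is small-time approximately reachable. -/
theorem euclidean_horizontal_shears_reachable
    (d : ℕ) (V0 : (Fin d → ℝ) → ℝ) (hV0 : ContDiff ℝ (⊤ : ℕ∞) V0)
    (hLip : ∃ L : NNReal, LipschitzWith L (fderiv ℝ V0)) :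
    ∀ g : (Fin d → ℝ) → ℝ, ContDiff ℝ (⊤ : ℕ∞) g →
      SmallTimeReachable (eucHam V0) (hshear g) := by
  intro g hg
  obtain ⟨L, hL⟩ := hLip
  exact (main_thm hV0 hL hg).small
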